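/- A sequence of non-negative integers a_1 a_2 ⋯ is the (−β)-expansion of −β/(β+1) for some (necessarily unique) β > 1 if and only if it satisfies conditions (G), (L), (A1) and (A2). -/

import Mathlib

open Filter Set

/-- The (−β)-transformation on [−β/(β+1), 1/(β+1)). -/
noncomputable def negBetaT (β : ℝ) (x : ℝ) : ℝ := -β * x - ⌊β / (β + 1) - β * x⌋

/-- The digits of the (−β)-expansion of x; `negBetaDigit β x n` is ε_{n+1}(x). -/
noncomputable def negBetaDigit (β : ℝ) (x : ℝ) (n : ℕ) : ℤ :=
  ⌊β / (β + 1) - β * ((negBetaT β)^[n] x)⌋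

/-- The (−β)-expansion of the left endpoint −β/(β+1); index n represents a_{n+1}. -/
noncomputable def negBetaExp (β : ℝ) (n : ℕ) : ℤ := negBetaDigit β (-β / (β + 1)) n

/-- `b` is the (−β)-expansion of `x`. -/
def IsNegBetaExpOf (β : ℝ) (x : ℝ) (b : ℕ → ℤ) : Prop :=
  x ∈ Set.Ico (-β / (β + 1)) (1 / (β + 1)) ∧ ∀ n, b n = negBetaDigit β x n

/-- Alternating lexicographic strict order (0-based indexing: index k corresponds
to position k+1, so `Even k` means odd position). -/
def AltLt (x y : ℕ → ℤ) : Prop :=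
  ∃ k, (∀ i, i < k → x i = y i) ∧ (if Even k then x k < y k else y k < x k)

/-- Alternating lexicographic order. -/
def AltLe (x y : ℕ → ℤ) : Prop := AltLt x y ∨ x = y

def phiW : ℕ → List ℕ
  | 1 => [1, 0, 0]
  | _ => [1]

/-- `uWord n` is φ^n(1), where φ(1) = 100, φ(0) = 1. -/
def uWord : ℕ → List ℕ
  | 0 => [1]
  | n + 1 => (uWord n).flatMap phiW

/-- The sequence u = 100111001001001110011⋯ starting with φ^n(1) for all n. -/
def uSeq (n : ℕ) : ℤ := ((uWord (n + 1)).getD n 0 : ℕ)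

/-- Condition (G): every shifted sequence is ≤_alt the sequence itself. -/
def CondG (a : ℕ → ℤ) : Prop := ∀ k, 1 ≤ k → AltLe (fun n => a (n + k)) a

/-- Condition (L): a >_alt u. -/
def CondL (a : ℕ → ℤ) : Prop := AltLt uSeq a

/-- The periodic sequence (w)^∞. -/
def perSeq (w : List ℤ) : ℕ → ℤ := fun n => w.getD (n % w.length) 0

/-- `a` is an infinite concatenation of blocks from `S`. -/
def IsInfConcat (S : Set (List ℤ)) (a : ℕ → ℤ) : Prop :=
  ∃ w : ℕ → List ℤ, (∀ n, w n ∈ S) ∧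
    ∀ N i, i < (((List.range N).map w).flatten).length →
      (((List.range N).map w).flatten).getD i 0 = a i

/-- Condition (A1). -/
def CondA1 (a : ℕ → ℤ) : Prop :=
  ∀ k, 1 ≤ k → AltLt uSeq (perSeq ((List.range k).map a)) →
    IsInfConcat {(List.range k).map a, (List.range (k - 1)).map a ++ [a (k - 1) - 1, 0]} a →
    a = perSeq ((List.range k).map a)

/-- Condition (A2). -/
def CondA2 (a : ℕ → ℤ) : Prop :=
  ∀ k, 1 ≤ k → AltLt uSeq (perSeq ((List.range (k - 1)).map a ++ [a (k - 1) + 1])) →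
    ¬ IsInfConcat {(List.range k).map a ++ [0], (List.range (k - 1)).map a ++ [a (k - 1) + 1]} a

/-- The cylinder set I_{b_1⋯b_n}. -/
def cylinder (β : ℝ) (w : List ℤ) : Set ℝ :=
  {x | x ∈ Set.Ico (-β / (β + 1)) (1 / (β + 1)) ∧
    ∀ i, i < w.length → negBetaDigit β x i = w.getD i 0}

/-- L_{β,n}: the number of words of length n with nonempty cylinder. -/
noncomputable def Lnum (β : ℝ) (n : ℕ) : ℕ :=
  Set.ncard {w : List ℤ | w.length = n ∧ (cylinder β w).Nonempty}

/-- L'_{β,n}: the number of words of length n whose cylinder is an interval of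
positive length. -/
noncomputable def Lnum' (β : ℝ) (n : ℕ) : ℕ :=
  Set.ncard {w : List ℤ | w.length = n ∧
    ∃ c d : ℝ, c < d ∧ Set.Ioo c d ⊆ cylinder β w ∧ cylinder β w ⊆ Set.Icc c d}

/-- P_n(x) = (−x)^n + Σ_{j=1}^n (a_j+1)(−x)^{n−j}. -/
noncomputable def Pn (a : ℕ → ℤ) (n : ℕ) (x : ℝ) : ℝ :=
  (-x) ^ n + ∑ j ∈ Finset.range n, ((a j : ℝ) + 1) * (-x) ^ (n - 1 - j)

/-- J_n = {x > 1 : P_j(x) ∈ [0,1] for all 1 ≤ j ≤ n}. -/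
def Jn (a : ℕ → ℤ) (n : ℕ) : Set ℝ :=
  {x | 1 < x ∧ ∀ j, 1 ≤ j → j ≤ n → Pn a j x ∈ Set.Icc (0 : ℝ) 1}


/-! ### Alternating lexicographic order -/

theorem AltLt.asymm {x y : ℕ → ℤ} (h : AltLt x y) : ¬ AltLt y x := by
  rintro ⟨l, hl, hl'⟩
  obtain ⟨k, hk, hk'⟩ := h
  rcases lt_trichotomy k l with h | h | h
  · have := hl k h
    split_ifs at hk' <;> omega
  · subst h
    split_ifs at hk' hl' <;> omega
  · have := hk l h
    split_ifs at hl' <;> omega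

theorem exists_first_diff {x y : ℕ → ℤ} (h : x ≠ y) :
    ∃ k, (∀ i, i < k → x i = y i) ∧ x k ≠ y k := by
  have h' : ∃ k, x k ≠ y k := Function.ne_iff.mp h
  classical
  exact ⟨Nat.find h', fun i hi => by simpa using Nat.find_min h' hi, Nat.find_spec h'⟩

theorem altLt_of_first_diff {x y : ℕ → ℤ} {k : ℕ} (h : ∀ i, i < k → x i = y i)
    (he : Even k → x k < y k) (ho : ¬ Even k → y k < x k) : AltLt x y :=
  ⟨k, h, by split_ifs with hk; exacts [he hk, ho hk]⟩

theorem altLe_of_not_altLt {x y : ℕ → ℤ} (h : ¬ AltLt x y) : AltLe y x := by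
  by_cases hxy : x = y
  · exact Or.inr hxy.symm
  · obtain ⟨k, hk, hne⟩ := exists_first_diff hxy
    refine Or.inl (altLt_of_first_diff (k := k) (fun i hi => (hk i hi).symm) ?_ ?_)
    · intro he
      by_contra hc
      exact h (altLt_of_first_diff hk (fun _ => by omega) (fun h => absurd he h))
    · intro ho
      by_contra hc
      exact h (altLt_of_first_diff hk (fun h => absurd h ho) (fun _ => by omega))

/-- The first differing digit of two comparable sequences has the expected sign. -/
theorem AltLe.sign {x y : ℕ → ℤ} (h : AltLe x y) {k : ℕ} (hk : ∀ i, i < k → x i = y i) :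
    (Even k → x k ≤ y k) ∧ (¬ Even k → y k ≤ x k) := by
  rcases h with ⟨l, hl, hl'⟩ | rfl
  · rcases lt_trichotomy k l with h | h | h
    · have := hl k h
      constructor <;> intro <;> omega
    · subst h
      split_ifs at hl' with hp
      · exact ⟨fun _ => hl'.le, fun h => absurd hp h⟩
      · exact ⟨fun h => absurd h hp, fun _ => hl'.le⟩
    · have := hk l h
      split_ifs at hl' <;> omega
  · exact ⟨fun _ => le_rfl, fun _ => le_rfl⟩

theorem AltLt.congr_left {x x' y : ℕ → ℤ} {k : ℕ} (hk : ∀ i, i < k → x i = y i)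
    (hs : if Even k then x k < y k else y k < x k) (h : ∀ i, i ≤ k → x' i = x i) :
    AltLt x' y :=
  ⟨k, fun i hi => by rw [h i hi.le, hk i hi], by rw [h k le_rfl]; exact hs⟩

theorem AltLt.congr_right {x y y' : ℕ → ℤ} {k : ℕ} (hk : ∀ i, i < k → x i = y i)
    (hs : if Even k then x k < y k else y k < x k) (h : ∀ i, i ≤ k → y' i = y i) :
    AltLt x y' :=
  ⟨k, fun i hi => by rw [h i hi.le, hk i hi], by rw [h k le_rfl]; exact hs⟩

/-! ### Blocks and infinite concatenations -/

/-- The word `l` occurs in `a` at position `s`. -/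
def BlockAt (a : ℕ → ℤ) (s : ℕ) (l : List ℤ) : Prop :=
  ∀ i, i < l.length → a (s + i) = l.getD i 0

theorem blockAt_append {a : ℕ → ℤ} {s : ℕ} {l l' : List ℤ} :
    BlockAt a s (l ++ l') ↔ BlockAt a s l ∧ BlockAt a (s + l.length) l' := by
  constructor
  · intro h
    refine ⟨fun i hi => ?_, fun i hi => ?_⟩
    · rw [h i (by simp; omega), List.getD_append _ _ _ _ hi]
    · rw [add_assoc, h _ (by simp; omega), List.getD_append_right _ _ _ _ (by omega)]
      simp
  · rintro ⟨h, h'⟩ i hi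
    rw [List.length_append] at hi
    by_cases hl : i < l.length
    · rw [List.getD_append _ _ _ _ hl, h i hl]
    · rw [List.getD_append_right _ _ _ _ (by omega), ← h' _ (by omega)]
      congr 1
      omega

/-- The starting position of the `N`-th block of a sequence of blocks. -/
def blockPos {ι : Type*} (f : ι → List ℤ) (x : ℕ → ι) (N : ℕ) : ℕ :=
  ∑ i ∈ Finset.range N, (f (x i)).length

@[simp] theorem blockPos_zero {ι : Type*} (f : ι → List ℤ) (x : ℕ → ι) : blockPos f x 0 = 0 := by
  simp [blockPos]

theorem blockPos_succ {ι : Type*} (f : ι → List ℤ) (x : ℕ → ι) (N : ℕ) :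
    blockPos f x (N + 1) = blockPos f x N + (f (x N)).length := by
  simp [blockPos, Finset.sum_range_succ]

/-- `a` is the concatenation of the blocks `f (x 0), f (x 1), …`. -/
def Parse {ι : Type*} (f : ι → List ℤ) (x : ℕ → ι) (a : ℕ → ℤ) : Prop :=
  ∀ N, BlockAt a (blockPos f x N) (f (x N))

theorem exists_parse {ι : Type*} {f : ι → List ℤ} {a : ℕ → ℤ} (S : ℕ → Prop) (h0 : S 0)
    (hS : ∀ s, S s → ∃ b, BlockAt a s (f b) ∧ S (s + (f b).length)) :
    ∃ x, Parse f x a := by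
  have : Nonempty ι := ⟨(hS 0 h0).choose⟩
  choose! g hg hg' using hS
  let q : ℕ → ℕ := fun n => (fun s => s + (f (g s)).length)^[n] 0
  have hq : ∀ n, q (n + 1) = q n + (f (g (q n))).length := fun n => by
    simp only [q, Function.iterate_succ_apply']
  have hqS : ∀ n, S (q n) := by
    intro n
    induction n with
    | zero => exact h0
    | succ n ih => rw [hq]; exact hg' _ ih
  have hpos : ∀ n, blockPos f (fun n => g (q n)) n = q n := by
    intro n
    induction n with
    | zero => simp [q]
    | succ n ih => rw [blockPos_succ, ih, hq]
  exact ⟨fun n => g (q n), fun N => by rw [hpos]; exact hg _ (hqS N)⟩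

theorem length_flatten_range (w : ℕ → List ℤ) (N : ℕ) :
    (((List.range N).map w).flatten).length = blockPos id w N := by
  induction N with
  | zero => simp
  | succ N ih => rw [List.range_succ, blockPos_succ]; simp [← ih]

theorem isInfConcat_iff {S : Set (List ℤ)} {a : ℕ → ℤ} :
    IsInfConcat S a ↔ ∃ w : ℕ → List ℤ, (∀ n, w n ∈ S) ∧ Parse id w a := by
  have key : ∀ w : ℕ → List ℤ, (∀ N, BlockAt a 0 (((List.range N).map w).flatten)) ↔
      Parse id w a := by
    intro w
    have hsucc : ∀ N, ((List.range (N + 1)).map w).flatten =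
        ((List.range N).map w).flatten ++ w N := fun N => by simp [List.range_succ]
    constructor
    · intro h N
      have := h (N + 1)
      rw [hsucc, blockAt_append, length_flatten_range, zero_add] at this
      exact this.2
    · intro h N
      induction N with
      | zero => intro i hi; simp at hi
      | succ N ih =>
        rw [hsucc, blockAt_append, length_flatten_range, zero_add]
        exact ⟨ih, h N⟩
  refine exists_congr fun w => and_congr_right fun _ => ?_
  rw [← key]
  refine forall_congr' fun N => forall_congr' fun i => forall_congr' fun _ => ?_
  rw [zero_add]
  exact eq_comm

/-! ### Orbits of the right endpoint in the flipped coordinate -/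

/-- The orbit of `1` under `y ↦ a n + 1 - β y`; for the digits of the `(-β)`-expansion of
`-β/(β+1)` this is the orbit of that point in the coordinate `1/(β+1) - x`. -/
noncomputable def orb (β : ℝ) (a : ℕ → ℤ) : ℕ → ℝ
  | 0 => 1
  | n + 1 => a n + 1 - β * orb β a n

/-- `a` codes an orbit of `1` staying in the closed unit interval. -/
def ClosedAt (β : ℝ) (a : ℕ → ℤ) : Prop := ∀ n, 0 ≤ orb β a n ∧ orb β a n ≤ 1

theorem orb_congr {β : ℝ} {a b : ℕ → ℤ} {n : ℕ} (h : ∀ i, i < n → a i = b i) :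
    orb β a n = orb β b n := by
  induction n with
  | zero => rfl
  | succ n ih => rw [orb, orb, ih fun i hi => h i (by omega), h n (by omega)]

theorem orb_add {β : ℝ} {a : ℕ → ℤ} {s : ℕ} (h : orb β a s = 1) (n : ℕ) :
    orb β a (s + n) = orb β (fun i => a (s + i)) n := by
  induction n with
  | zero => simpa [orb] using h
  | succ n ih => rw [← add_assoc, orb, orb, ih]

theorem continuous_orb (a : ℕ → ℤ) (n : ℕ) : Continuous fun β => orb β a n := by
  induction n with
  | zero => exact continuous_const
  | succ n ih => simp only [orb]; fun_prop

theorem eq_of_floor_orb {β : ℝ} {a b : ℕ → ℤ} (ha : ∀ n, a n = ⌊β * orb β a n⌋)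
    (hb : ∀ n, b n = ⌊β * orb β b n⌋) : a = b := by
  funext n
  induction n using Nat.strong_induction_on with
  | _ n ih => rw [ha, hb, orb_congr ih]

theorem floor_orb_iff {β : ℝ} {a : ℕ → ℤ} :
    (∀ n, a n = ⌊β * orb β a n⌋) ↔ ∀ n, 0 < orb β a n ∧ orb β a n ≤ 1 := by
  have key : ∀ n, a n = ⌊β * orb β a n⌋ ↔ 0 < orb β a (n + 1) ∧ orb β a (n + 1) ≤ 1 := by
    intro n
    rw [eq_comm, Int.floor_eq_iff, orb]
    constructor <;> rintro ⟨h, h'⟩ <;> constructor <;> linarith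
  constructor
  · rintro h (_ | n)
    · simp [orb]
    · exact (key n).1 (h n)
  · exact fun h n => (key n).2 (h (n + 1))

theorem negBetaExp_floor {β : ℝ} (hβ : 1 < β) (n : ℕ) :
    negBetaExp β n = ⌊β * orb β (negBetaExp β) n⌋ := by
  have hb : β + 1 ≠ 0 := by linarith
  have hd : ∀ n, negBetaExp β n =
      ⌊β / (β + 1) - β * ((negBetaT β)^[n] (-β / (β + 1)))⌋ := fun n => rfl
  have ho : ∀ n, orb β (negBetaExp β) n = 1 / (β + 1) - (negBetaT β)^[n] (-β / (β + 1)) := by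
    intro n
    induction n with
    | zero => simp only [orb, Function.iterate_zero, id_eq]; field_simp; ring
    | succ n ih =>
      rw [orb, ih, Function.iterate_succ_apply', negBetaT, ← hd]
      field_simp
      ring
  rw [ho, hd]
  congr 1
  field_simp

theorem eq_negBetaExp_iff {β : ℝ} (hβ : 1 < β) {a : ℕ → ℤ} :
    (∀ n, a n = negBetaExp β n) ↔ ∀ n, 0 < orb β a n ∧ orb β a n ≤ 1 := by
  rw [← floor_orb_iff]
  constructor
  · intro h
    obtain rfl : a = negBetaExp β := funext h
    exact negBetaExp_floor hβ
  · exact fun h n => congrFun (eq_of_floor_orb h (negBetaExp_floor hβ)) n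

theorem orb_negBetaExp {β : ℝ} (hβ : 1 < β) (n : ℕ) :
    0 < orb β (negBetaExp β) n ∧ orb β (negBetaExp β) n ≤ 1 :=
  (eq_negBetaExp_iff hβ).1 (fun _ => rfl) n

theorem closedAt_negBetaExp {β : ℝ} (hβ : 1 < β) : ClosedAt β (negBetaExp β) :=
  fun n => ⟨(orb_negBetaExp hβ n).1.le, (orb_negBetaExp hβ n).2⟩

theorem negBetaExp_nonneg {β : ℝ} (hβ : 1 < β) (n : ℕ) : 0 ≤ negBetaExp β n := by
  rw [negBetaExp_floor hβ]
  exact Int.floor_nonneg.2 (mul_nonneg (by linarith) (orb_negBetaExp hβ n).1.le)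

/-- A quantity that is bounded and whose upper bounds contract is nonpositive. -/
theorem nonpos_of_contracting {f : ℕ → ℝ} {q : ℝ} (hq : 1 < q) (hb : ∃ C, ∀ n, f n ≤ C)
    (hs : ∀ C, 0 ≤ C → (∀ n, f n ≤ C) → ∀ n, f n ≤ C / q) (n : ℕ) : f n ≤ 0 := by
  obtain ⟨C, hC⟩ := hb
  have h : ∀ m n, f n ≤ max C 0 / q ^ m := by
    intro m
    induction m with
    | zero => intro n; simpa using Or.inl (hC n)
    | succ m ih =>
      intro n
      have := hs _ (by positivity) ih n
      rwa [div_div, ← pow_succ] at this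
  have ht : Tendsto (fun m : ℕ => max C 0 / q ^ m) atTop (nhds 0) :=
    Tendsto.const_div_atTop (tendsto_pow_atTop_atTop_of_one_lt hq) _
  exact ge_of_tendsto' ht fun m => h m n

/-! ### Tent orbits -/

/-- The orbit of `0` under the two branches `t ↦ p (1 - t)` (coded by `true`) and
`t ↦ r (t - 1)` (coded by `false`), in the order prescribed by `x`. -/
noncomputable def tent (p r : ℝ) (x : ℕ → Bool) : ℕ → ℝ
  | 0 => 0
  | n + 1 => if x n then p * (1 - tent p r x n) else r * (tent p r x n - 1)

/-- The tent orbit coded by `x` is nonnegative and bounded. -/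
def TentOK (p r : ℝ) (x : ℕ → Bool) : Prop :=
  (∀ n, 0 ≤ tent p r x n) ∧ ∃ C, ∀ n, tent p r x n ≤ C

theorem tent_true {p r : ℝ} {x : ℕ → Bool} {n : ℕ} (h : x n = true) :
    tent p r x (n + 1) = p * (1 - tent p r x n) := by simp [tent, h]

theorem tent_false {p r : ℝ} {x : ℕ → Bool} {n : ℕ} (h : x n = false) :
    tent p r x (n + 1) = r * (tent p r x n - 1) := by simp [tent, h]

namespace TentOK

variable {p r : ℝ} {x : ℕ → Bool}

theorem le_one (h : TentOK p r x) (hp : 1 < p) {n : ℕ} (hx : x n = true) :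
    tent p r x n ≤ 1 := by
  have := h.1 (n + 1)
  rw [tent_true hx] at this
  nlinarith

theorem one_le (h : TentOK p r x) (hr : 1 < r) {n : ℕ} (hx : x n = false) :
    1 ≤ tent p r x n := by
  have := h.1 (n + 1)
  rw [tent_false hx] at this
  nlinarith

theorem zero_true (h : TentOK p r x) (hr : 1 < r) : x 0 = true := by
  by_contra hx
  have := h.one_le hr (n := 0) (by simpa using hx)
  simp [tent] at this
  linarith

theorem tent_one (h : TentOK p r x) (hr : 1 < r) : tent p r x 1 = p := by
  rw [tent_true (h.zero_true hr)]
  simp [tent]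

theorem one_false (h : TentOK p r x) (hp : 1 < p) (hr : 1 < r) : x 1 = false := by
  by_contra hx
  have := h.le_one hp (n := 1) (by simpa using hx)
  rw [h.tent_one hr] at this
  linarith

theorem le_fixed (h : TentOK p r x) (hp : 1 < p) (hr : 1 < r) (n : ℕ) :
    (r - 1) * tent p r x n ≤ r := by
  by_contra! hn
  have key : ∀ m, (r - 1) * tent p r x (n + m) - r = r ^ m * ((r - 1) * tent p r x n - r) := by
    intro m
    induction m with
    | zero => simp
    | succ m ih =>
      have hpos : 0 < r ^ m * ((r - 1) * tent p r x n - r) := by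
        have : 0 < r ^ m := by positivity
        exact mul_pos this (by linarith)
      have hx : x (n + m) = false := by
        by_contra hx
        have := h.le_one hp (n := n + m) (by simpa using hx)
        nlinarith
      rw [← add_assoc, tent_false hx, pow_succ]
      linear_combination r * ih
  obtain ⟨C, hC⟩ := h.2
  have ht : Tendsto (fun m : ℕ => r ^ m * ((r - 1) * tent p r x n - r)) atTop atTop :=
    Tendsto.atTop_mul_const (by linarith) (tendsto_pow_atTop_atTop_of_one_lt hr)
  obtain ⟨m, hm⟩ := (ht.eventually_gt_atTop ((r - 1) * C - r)).exists
  rw [← key] at hm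
  nlinarith [hC (n + m)]

theorem param_le (h : TentOK p r x) (hp : 1 < p) (hr : 1 < r) : p * (r - 1) ≤ r := by
  have := h.le_fixed hp hr 1
  rw [h.tent_one hr] at this
  linarith

theorem tent_le (h : TentOK p r x) (hp : 1 < p) (hr : 1 < r) (n : ℕ) : tent p r x n ≤ p := by
  induction n with
  | zero => simp [tent]; linarith
  | succ n ih =>
    cases hx : x n
    · rw [tent_false hx]
      nlinarith [h.param_le hp hr]
    · rw [tent_true hx]
      nlinarith [h.1 n]

theorem even_true (h : TentOK p r x) (hp : 1 < p) (hr : 1 < r) (hren : r * (p ^ 2 - 1) ≤ p)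
    (n : ℕ) : x (2 * n) = true := by
  have hlt : p / (p + 1) < 1 := by rw [div_lt_one] <;> linarith
  have hA : ∀ n, tent p r x (2 * n) ≤ p / (p + 1) → x (2 * n) = true := by
    intro n hn
    by_contra hx
    have := h.one_le hr (n := 2 * n) (by simpa using hx)
    linarith
  have key : ∀ n, tent p r x (2 * n) ≤ p / (p + 1) := by
    intro n
    induction n with
    | zero => simp [tent]; positivity
    | succ n ih =>
      have hx := hA n ih
      have h0 := h.1 (2 * n)
      rw [le_div_iff₀ (by linarith)] at ih ⊢
      rw [show 2 * (n + 1) = 2 * n + 1 + 1 by ring]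
      cases hx1 : x (2 * n + 1)
      · rw [tent_false hx1, tent_true hx]
        have : r * (p * (1 - tent p r x (2 * n)) - 1) ≤ r * (p - 1) := by
          apply mul_le_mul_of_nonneg_left _ (by linarith)
          nlinarith
        nlinarith
      · rw [tent_true hx1, tent_true hx]
        nlinarith
  exact hA n (key n)

theorem doubling (h : TentOK p r x) (hp : 1 < p) (hx : ∀ n, x (2 * n) = true) :
    TentOK (p * r) (p ^ 2) (fun n => !x (2 * n + 1)) := by
  have hp1 : p - 1 ≠ 0 := by linarith
  have key : ∀ n, tent (p * r) (p ^ 2) (fun n => !x (2 * n + 1)) n =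
      tent p r x (2 * n) * (p / (p - 1)) := by
    intro n
    induction n with
    | zero => simp [tent]
    | succ n ih =>
      rw [show 2 * (n + 1) = 2 * n + 1 + 1 by ring]
      cases hx1 : x (2 * n + 1)
      · rw [tent_false hx1, tent_true (hx n), tent_true (by simp [hx1]), ih]
        field_simp
        ring
      · rw [tent_true hx1, tent_true (hx n), tent_false (by simp [hx1]), ih]
        field_simp
        ring
  have hc : 0 ≤ p / (p - 1) := div_nonneg (by linarith) (by linarith)
  obtain ⟨C, hC⟩ := h.2
  refine ⟨fun n => ?_, C * (p / (p - 1)), fun n => ?_⟩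
  · rw [key]
    exact mul_nonneg (h.1 _) hc
  · rw [key]
    exact mul_le_mul_of_nonneg_right (hC _) hc

end TentOK

/-! ### The blocks of the substitution -/

/-- The pair of words obtained from `1` and `00` by iterating `φ`. -/
def blkN : ℕ → Bool → List ℕ
  | 0, true => [1]
  | 0, false => [0, 0]
  | m + 1, b => blkN m true ++ blkN m (!b)

/-- The words `blkN m b` with integer letters. -/
def blk (m : ℕ) (b : Bool) : List ℤ := (blkN m b).map Nat.cast

theorem blk_succ (m : ℕ) (b : Bool) : blk (m + 1) b = blk m true ++ blk m (!b) := by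
  simp [blk, blkN]

theorem flatMap_phiW_blkN (m : ℕ) (b : Bool) : (blkN m b).flatMap phiW = blkN (m + 1) b := by
  induction m generalizing b with
  | zero => cases b <;> rfl
  | succ m ih =>
    rw [blkN, List.flatMap_append, ih, ih]
    rfl

theorem uWord_eq (m : ℕ) : uWord m = blkN m true := by
  induction m with
  | zero => rfl
  | succ m ih => rw [uWord, ih, flatMap_phiW_blkN]

theorem blk_length_succ (m : ℕ) (b : Bool) :
    (blk (m + 1) b).length = (blk m true).length + (blk m !b).length := by
  rw [blk_succ, List.length_append]

theorem blk_length (m : ℕ) : Odd (blk m true).length ∧ Even (blk m false).length ∧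
    ((blk m false).length = (blk m true).length + 1 ∨
      (blk m true).length = (blk m false).length + 1 ∧ 2 ≤ (blk m false).length) := by
  induction m with
  | zero => simp [blk, blkN]
  | succ m ih =>
    obtain ⟨h1, h2, h3⟩ := ih
    rw [blk_length_succ, blk_length_succ, Bool.not_true, Bool.not_false]
    have := h1.pos
    exact ⟨h1.add_even h2, h1.add_odd h1, by omega⟩

theorem lt_blk_length (m : ℕ) : m < (blk m true).length := by
  induction m with
  | zero => simp [blk, blkN]
  | succ m ih =>
    rw [blk_length_succ]
    have := blk_length m
    simp only [Bool.not_true]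
    omega

theorem blk_true_prefix {m n : ℕ} (h : m ≤ n) : blk m true <+: blk n true := by
  induction n, h using Nat.le_induction with
  | base => exact List.prefix_rfl
  | succ n _ ih => exact ih.trans (by rw [blk_succ]; exact List.prefix_append _ _)

theorem getD_eq_of_prefix {l l' : List ℤ} (h : l <+: l') {i : ℕ} (hi : i < l.length) :
    l'.getD i 0 = l.getD i 0 := by
  obtain ⟨t, rfl⟩ := h
  exact List.getD_append _ _ _ _ hi

theorem blockAt_uSeq (m : ℕ) : BlockAt uSeq 0 (blk m true) := by
  intro i hi
  have hu : uSeq i = (blk (i + 1) true).getD i 0 := by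
    rw [uSeq, uWord_eq, blk]
    rw [List.getD_eq_getElem?_getD, List.getD_eq_getElem?_getD, List.getElem?_map]
    cases (blkN (i + 1) true)[i]? <;> rfl
  rw [zero_add, hu]
  rcases le_total m (i + 1) with h | h
  · exact getD_eq_of_prefix (blk_true_prefix h) hi
  · refine (getD_eq_of_prefix (blk_true_prefix h) ?_).symm
    have := lt_blk_length (i + 1)
    omega

/-- The two blocks of each level first differ inside both of them, with `blk m false` smaller. -/
theorem blk_first_diff (m : ℕ) : ∃ g, g < (blk m true).length ∧ g < (blk m false).length ∧
    (∀ i, i < g → (blk m false).getD i 0 = (blk m true).getD i 0) ∧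
    (Even g → (blk m false).getD g 0 < (blk m true).getD g 0) ∧
    (¬ Even g → (blk m true).getD g 0 < (blk m false).getD g 0) := by
  induction m with
  | zero => exact ⟨0, by simp [blk, blkN]⟩
  | succ m ih =>
    obtain ⟨g, h1, h2, h3, h4, h5⟩ := ih
    have hodd := (blk_length m).1
    have hg : ∀ b, (blk (m + 1) b).getD ((blk m true).length + g) 0 = (blk m !b).getD g 0 := by
      intro b
      rw [blk_succ, List.getD_append_right _ _ _ _ (by omega)]
      simp
    refine ⟨(blk m true).length + g, ?_, ?_, ?_, ?_, ?_⟩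
    · rw [blk_length_succ]; simpa using h2
    · rw [blk_length_succ]; simpa using h1
    · intro i hi
      by_cases hl : i < (blk m true).length
      · rw [blk_succ, blk_succ, List.getD_append _ _ _ _ hl, List.getD_append _ _ _ _ hl]
      · obtain ⟨j, rfl⟩ := Nat.exists_eq_add_of_le (not_lt.1 hl)
        rw [blk_succ, blk_succ, List.getD_append_right _ _ _ _ (by omega),
          List.getD_append_right _ _ _ _ (by omega)]
        simpa using (h3 j (by omega)).symm
    · intro he
      rw [hg, hg]
      refine h5 fun h => ?_
      exact Nat.not_even_iff_odd.2 (hodd.add_even h) he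
    · intro he
      rw [hg, hg]
      refine h4 ?_
      by_contra h
      exact he (hodd.add_odd (Nat.not_even_iff_odd.1 h))

theorem altLt_of_blocks {u a : ℕ → ℤ} {m : ℕ} {P : List ℤ} {b : Bool} (hu : BlockAt u 0 P)
    (ha : BlockAt a 0 P) (hb : b = true ↔ Odd P.length) (hu' : BlockAt u P.length (blk m b))
    (ha' : BlockAt a P.length (blk m !b)) : AltLt u a := by
  obtain ⟨g, h1, h2, h3, h4, h5⟩ := blk_first_diff m
  have hpre : ∀ i, i < P.length + g → u i = a i := by
    intro i hi
    by_cases hl : i < P.length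
    · have h1 := hu i hl
      have h2 := ha i hl
      rw [zero_add] at h1 h2
      rw [h1, h2]
    · obtain ⟨j, rfl⟩ := Nat.exists_eq_add_of_le (not_lt.1 hl)
      have := h3 j (by omega)
      cases b
      · rw [hu' j (by omega), ha' j (by simp; omega)]
        simpa using this
      · rw [hu' j (by omega), ha' j (by simp; omega)]
        simpa using this.symm
  cases b
  · have hev : Even P.length := by simpa using hb
    refine altLt_of_first_diff hpre ?_ ?_ <;> rw [hu' g h2, ha' g (by simpa using h1)] <;> intro he
    · exact h4 (by simpa [Nat.even_add, hev] using he)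
    · exact h5 (by simpa [Nat.even_add, hev] using he)
  · have hev : ¬ Even P.length := by simpa using hb
    refine altLt_of_first_diff hpre ?_ ?_ <;> rw [hu' g h1, ha' g (by simpa using h2)] <;> intro he
    · exact h5 (by simpa [Nat.even_add, hev] using he)
    · exact h4 (by simpa [Nat.even_add, hev] using he)

/-! ### Renormalization levels -/

theorem Parse.doubling {m : ℕ} {x : ℕ → Bool} {a : ℕ → ℤ} (h : Parse (blk m) x a)
    (hx : ∀ n, x (2 * n) = true) : Parse (blk (m + 1)) (fun n => !x (2 * n + 1)) a := by
  have hpos : ∀ N, blockPos (blk (m + 1)) (fun n => !x (2 * n + 1)) N =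
      blockPos (blk m) x (2 * N) := by
    intro N
    induction N with
    | zero => simp
    | succ N ih =>
      rw [blockPos_succ, ih, show 2 * (N + 1) = 2 * N + 1 + 1 by ring, blockPos_succ,
        blockPos_succ, blk_length_succ, hx, Bool.not_not, add_assoc]
  intro N
  rw [hpos, blk_succ, blockAt_append, Bool.not_not]
  have h1 := h (2 * N)
  have h2 := h (2 * N + 1)
  rw [blockPos_succ] at h2
  rw [hx] at h1 h2
  exact ⟨h1, h2⟩

/-- `a` is a concatenation, coded by `x`, of blocks of level `m`, and the associated tent orbit
at base `β` is well behaved. -/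
def Lev (m : ℕ) (β : ℝ) (a : ℕ → ℤ) (x : ℕ → Bool) : Prop :=
  Parse (blk m) x a ∧ TentOK (β ^ (blk m true).length) (β ^ (blk m false).length) x

theorem one_lt_pow_blk {β : ℝ} (hβ : 1 < β) (m : ℕ) (b : Bool) :
    1 < β ^ (blk m b).length := by
  refine one_lt_pow₀ hβ ?_
  have := blk_length m
  have := this.1.pos
  cases b <;> omega

theorem TentOK.doubling_blk {β : ℝ} (hβ : 1 < β) {m : ℕ} {x : ℕ → Bool}
    (h : TentOK (β ^ (blk m true).length) (β ^ (blk m false).length) x)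
    (hx : ∀ n, x (2 * n) = true) :
    TentOK (β ^ (blk (m + 1) true).length) (β ^ (blk (m + 1) false).length)
      (fun n => !x (2 * n + 1)) := by
  have := h.doubling (one_lt_pow_blk hβ m true) hx
  rw [← pow_add, ← pow_mul, mul_two] at this
  rwa [blk_length_succ, blk_length_succ]

theorem Lev.succ {m : ℕ} {β : ℝ} {a : ℕ → ℤ} {x : ℕ → Bool} (h : Lev m β a x) (hβ : 1 < β)
    (hx : ∀ n, x (2 * n) = true) : Lev (m + 1) β a (fun n => !x (2 * n + 1)) :=
  ⟨h.1.doubling hx, h.2.doubling_blk hβ hx⟩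

theorem ClosedAt.tentOK {β : ℝ} {a : ℕ → ℤ} {x : ℕ → Bool} (h : ClosedAt β a) (hβ : 1 < β)
    (hx : Parse (blk 0) x a) : TentOK (β ^ (blk 0 true).length) (β ^ (blk 0 false).length) x := by
  have hb : β - 1 ≠ 0 := by linarith
  have key : ∀ N, tent (β ^ (blk 0 true).length) (β ^ (blk 0 false).length) x N =
      (1 - orb β a (blockPos (blk 0) x N)) * (β / (β - 1)) := by
    intro N
    have h1 : (blk 0 true).length = 1 := rfl
    have h2 : (blk 0 false).length = 2 := rfl
    rw [h1, h2]
    induction N with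
    | zero => simp [tent, orb]
    | succ N ih =>
      have hN := hx N
      rw [blockPos_succ]
      cases hxN : x N
      · rw [hxN] at hN
        have e0 : a (blockPos (blk 0) x N) = 0 := hN 0 (by simp [blk, blkN])
        have e1 : a (blockPos (blk 0) x N + 1) = 0 := hN 1 (by simp [blk, blkN])
        have hs : orb β a (blockPos (blk 0) x N + (blk 0 false).length) =
            (0 : ℤ) + 1 - β * ((0 : ℤ) + 1 - β * orb β a (blockPos (blk 0) x N)) := by
          show orb β a (blockPos (blk 0) x N + 1 + 1) = _
          rw [orb, orb, e0, e1]
        rw [tent_false hxN, ih, hs]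
        push_cast
        field_simp
        ring
      · rw [hxN] at hN
        have e0 : a (blockPos (blk 0) x N) = 1 := hN 0 (by simp [blk, blkN])
        have hs : orb β a (blockPos (blk 0) x N + (blk 0 true).length) =
            (1 : ℤ) + 1 - β * orb β a (blockPos (blk 0) x N) := by
          rw [← e0]
          rfl
        rw [tent_true hxN, ih, hs]
        push_cast
        field_simp
        ring
  have hc : 0 ≤ β / (β - 1) := div_nonneg (by linarith) (by linarith)
  refine ⟨fun n => ?_, β / (β - 1), fun n => ?_⟩
  · rw [key]
    exact mul_nonneg (by linarith [(h (blockPos (blk 0) x n)).2]) hc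
  · rw [key]
    nlinarith [(h (blockPos (blk 0) x n)).1]

theorem ClosedAt.exists_lev {β : ℝ} {a : ℕ → ℤ} (h : ClosedAt β a) (hpos : ∀ n, 0 ≤ a n)
    (hβ : 1 < β) (hβ2 : β ^ 2 ≤ β + 1) : ∃ x, Lev 0 β a x := by
  suffices ∃ x, Parse (blk 0) x a from this.imp fun x hx => ⟨hx, h.tentOK hβ hx⟩
  have hlt : β < 2 := by nlinarith
  refine exists_parse (fun s => 2 - β ≤ orb β a s) (by simp [orb]; linarith) fun s hs => ?_
  have hd : ∀ n, (a n : ℝ) ≤ β * orb β a n := fun n => by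
    have := (h (n + 1)).2
    rw [orb] at this
    linarith
  have h1 := (h s).2
  have ha : a s < 2 := by
    have : (a s : ℝ) < 2 := by nlinarith [hd s]
    exact_mod_cast this
  have ha0 := hpos s
  obtain h0 | h1' : a s = 0 ∨ a s = 1 := by omega
  · have hy : orb β a (s + 1) = 1 - β * orb β a s := by rw [orb, h0]; simp
    have hbb : β * (β - 1) ≤ 1 := by nlinarith
    have hyy : orb β a (s + 1) ≤ (β - 1) ^ 2 := by nlinarith
    have hyb : β * orb β a (s + 1) ≤ β - 1 := by nlinarith
    have ha1 : a (s + 1) < 1 := by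
      have : (a (s + 1) : ℝ) < 1 := by linarith [hd (s + 1)]
      exact_mod_cast this
    have ha1' : a (s + 1) = 0 := by have := hpos (s + 1); omega
    refine ⟨false, ?_, ?_⟩
    · intro i hi
      have : i < 2 := hi
      interval_cases i
      · exact h0
      · exact ha1'
    · show 2 - β ≤ orb β a (s + 1 + 1)
      rw [orb, ha1']
      push_cast
      linarith
  · refine ⟨true, ?_, ?_⟩
    · intro i hi
      have : i < 1 := hi
      interval_cases i
      exact h1'
    · show 2 - β ≤ orb β a (s + 1)
      rw [orb, h1']
      push_cast
      nlinarith

/-! ### A sequence codes a closed orbit for at most one base -/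

theorem TentOK.rigid_bound {p r p' r' : ℝ} {x : ℕ → Bool} (h : TentOK p r x)
    (h' : TentOK p' r' x) (hp : 1 < p) (hr : 1 < r) (hpp : p < p') (hrr : r < r') {M : ℝ}
    (hM : p' - p ≤ M * (p' ^ 2 - 1)) (hM' : (r' - r) * (p - 1) ≤ M * (r' - 1)) :
    p' * (r' * (p' - p) + (r' - r) * (p - 1)) ≤ p' - p + M := by
  have hp0 : 0 < p' := by linarith
  have hr0 : 0 < r' := by linarith
  set R : ℕ → ℝ := fun n => tent p r x n - tent p' r' x n with hR
  set N : ℝ := (p' - p + M) / p' with hN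
  have hNM : N * p' = p' - p + M := by rw [hN]; field_simp
  have hbd : ∃ C, ∀ n, max (R n - M) (-R n - N) ≤ C := by
    obtain ⟨C, hC⟩ := h.2
    obtain ⟨C', hC'⟩ := h'.2
    refine ⟨max (C - M) (C' - N), fun n => max_le_max ?_ ?_⟩
    · linarith [hC n, h'.1 n]
    · linarith [hC' n, h.1 n]
  have hq : 1 < min p' r' := lt_min (by linarith) (by linarith)
  have hstep : ∀ C, 0 ≤ C → (∀ n, max (R n - M) (-R n - N) ≤ C) →
      ∀ n, max (R n - M) (-R n - N) ≤ C / min p' r' := by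
    intro C hC hb n
    have hb1 : R (n + 1) ≤ M + C := by linarith [(le_max_left _ _).trans (hb (n + 1))]
    have hb2 : -R (n + 1) ≤ N + C := by linarith [(le_max_right _ _).trans (hb (n + 1))]
    have hCp : C / p' ≤ C / min p' r' :=
      div_le_div_of_nonneg_left hC (by linarith) (min_le_left _ _)
    have hCr : C / r' ≤ C / min p' r' :=
      div_le_div_of_nonneg_left hC (by linarith) (min_le_right _ _)
    suffices max (R n - M) (-R n - N) ≤ C / p' ∨ max (R n - M) (-R n - N) ≤ C / r' from
      this.elim (fun h => h.trans hCp) (fun h => h.trans hCr)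
    cases hx : x n
    · right
      have e : R (n + 1) = -(r' - r) * (tent p r x n - 1) + r' * R n := by
        simp only [hR, tent_false hx]; ring
      have t1 := h.one_le hr hx
      have t2 := h.tent_le hp hr n
      have hN0 : 0 ≤ N := by
        apply div_nonneg _ hp0.le
        nlinarith
      have : (r' - r) * (tent p r x n - 1) ≤ (r' - r) * (p - 1) :=
        mul_le_mul_of_nonneg_left (by linarith) (by linarith)
      have : 0 ≤ (r' - r) * (tent p r x n - 1) := mul_nonneg (by linarith) (by linarith)
      refine max_le ?_ ?_ <;> rw [le_div_iff₀ hr0]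
      · nlinarith
      · nlinarith
    · left
      have e : R (n + 1) = -(p' - p) * (1 - tent p r x n) - p' * R n := by
        simp only [hR, tent_true hx]; ring
      have t1 := h.le_one hp hx
      have t2 := h.1 n
      have : 0 ≤ (p' - p) * (1 - tent p r x n) := mul_nonneg (by linarith) (by linarith)
      have : (p' - p) * (1 - tent p r x n) ≤ p' - p := by nlinarith
      have hMN : N ≤ M * p' := by
        rw [hN, div_le_iff₀ hp0]
        nlinarith
      refine max_le ?_ ?_ <;> rw [le_div_iff₀ hp0]
      · nlinarith
      · nlinarith
  have hx0 := h.zero_true hr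
  have hx1 := h.one_false hp hr
  have h2 := (le_max_right _ _).trans (nonpos_of_contracting hq hbd hstep 2)
  have e : R 2 = -((r' - r) * (p - 1) + r' * (p' - p)) := by
    simp only [hR]
    rw [tent_false (n := 1) hx1, tent_false (n := 1) hx1, h.tent_one hr, h'.tent_one (by linarith)]
    ring
  rw [e] at h2
  nlinarith

theorem rigid_ineq_of_le {P R : ℝ} (hP : 1 < P) (hPR : P ≤ R) (h : P < R * (P ^ 2 - 1)) :
    2 * (1 + P - P * R) < P * R - 1 := by
  by_cases hP2 : P ≤ 3 / 2
  · have : 1 < P * R - 1 := by nlinarith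
    linarith
  · nlinarith

theorem rigid_ineq_of_ge {P R : ℝ} (hR : 1 < R) (hRP : R ≤ P) (hPR : P ^ 2 ≤ R ^ 3)
    (h : P < R * (P ^ 2 - 1)) : R * (P - 1) * (1 + P - P * R) < P * (P * R - 1) * (R - 1) := by
  suffices R * ((2 * P - 1) * (1 + P - P * R)) < P by nlinarith
  have hP : 1 < P := by linarith
  by_cases hP3 : P ^ 3 - P ^ 2 ≤ 1
  · have hs : 0 < P ^ 2 - 1 := by nlinarith
    have hu : 0 < R * (P ^ 2 - 1) - P := by linarith
    have key : (P ^ 2 - 1) ^ 2 * (P - R * ((2 * P - 1) * (1 + P - P * R))) =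
        P ^ 2 * (1 + P ^ 2 - P ^ 3) +
        (2 * P - 1) * (R * (P ^ 2 - 1) - P) * (1 + P + P ^ 2 - P ^ 3) +
        (2 * P - 1) * P * (R * (P ^ 2 - 1) - P) ^ 2 := by ring
    have h1 : 0 ≤ P ^ 2 * (1 + P ^ 2 - P ^ 3) := mul_nonneg (by positivity) (by linarith)
    have h2 : 0 < (2 * P - 1) * (R * (P ^ 2 - 1) - P) * (1 + P + P ^ 2 - P ^ 3) :=
      mul_pos (mul_pos (by linarith) hu) (by linarith)
    have h3 : 0 ≤ (2 * P - 1) * P * (R * (P ^ 2 - 1) - P) ^ 2 :=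
      mul_nonneg (mul_nonneg (by linarith) (by linarith)) (by positivity)
    have h4 : 0 < (P ^ 2 - 1) ^ 2 * (P - R * ((2 * P - 1) * (1 + P - P * R))) := by linarith
    linarith [pos_of_mul_pos_right h4 (by positivity)]
  by_cases hneg : 1 + P - P * R ≤ 0
  · have : R * ((2 * P - 1) * (1 + P - P * R)) ≤ 0 :=
      mul_nonpos_of_nonneg_of_nonpos (by linarith)
        (mul_nonpos_of_nonneg_of_nonpos (by linarith) hneg)
    linarith
  have hP' : 1.465 < P := by
    by_contra hc
    nlinarith
  have hP4 : P < 4 := by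
    have hR2 : R < 2 := by nlinarith
    have : R ^ 3 < 2 ^ 3 := pow_lt_pow_left₀ hR2 (by linarith) (by norm_num)
    nlinarith
  have hR0 : 0.6 + 0.47 * P ≤ R := by
    by_contra! hc
    have : R ^ 3 < (0.6 + 0.47 * P) ^ 3 := pow_lt_pow_left₀ hc (by linarith) (by norm_num)
    nlinarith [mul_nonneg (sub_nonneg.2 hP'.le) (sub_nonneg.2 hP4.le),
      mul_nonneg (mul_nonneg (sub_nonneg.2 hP'.le) (sub_nonneg.2 hP4.le)) (by linarith : 0 ≤ P)]
  have h1 : R * (1 + P - P * R) ≤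
      (0.6 + 0.47 * P) * (1 + P - P * (0.6 + 0.47 * P)) := by
    have : 0 ≤ P * (R + (0.6 + 0.47 * P)) - (1 + P) := by nlinarith
    nlinarith [mul_nonneg (sub_nonneg.2 hR0) this]
  have h2 : (2 * P - 1) * (R * (1 + P - P * R)) ≤
      (2 * P - 1) * ((0.6 + 0.47 * P) * (1 + P - P * (0.6 + 0.47 * P))) :=
    mul_le_mul_of_nonneg_left h1 (by linarith)
  have h3 : (2 * P - 1) * ((0.6 + 0.47 * P) * (1 + P - P * (0.6 + 0.47 * P))) < P := by
    have hd : 0 < P - 1.465 := by linarith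
    obtain ⟨d, rfl⟩ : ∃ d, P = d + 1.465 := ⟨P - 1.465, by ring⟩
    have hd' : 0 < d := by linarith
    nlinarith [pow_pos hd' 2, pow_pos hd' 3, pow_pos hd' 4]
  linarith

theorem TentOK.rigid_of_ineq {p r P R : ℝ} {x : ℕ → Bool} (h : TentOK p r x)
    (h' : TentOK P R x) (hp : 1 < p) (hr : 1 < r) (hpp : p < P) (hrr : r < R)
    (hnr : P < R * (P ^ 2 - 1))
    (hle : 0 < 1 + P - P * R →
      P * ((R - r) * (P - 1) * (1 + P - P * R)) < P * ((P - p) * (R - 1) * (P * R - 1))) :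
    False := by
  have hP : 1 < P := hp.trans hpp
  have hR : 1 < R := hr.trans hrr
  have hP2 : 0 < P ^ 2 - 1 := by nlinarith
  have hR1 : 0 < R - 1 := by linarith
  set M := max ((P - p) / (P ^ 2 - 1)) ((R - r) * (p - 1) / (R - 1)) with hM
  have hb := h.rigid_bound h' hp hr hpp hrr (M := M)
    ((div_le_iff₀ hP2).1 (le_max_left _ _)) ((div_le_iff₀ hR1).1 (le_max_right _ _))
  have hB : 0 ≤ (R - r) * (p - 1) := mul_nonneg (by linarith) (by linarith)
  rcases max_choice ((P - p) / (P ^ 2 - 1)) ((R - r) * (p - 1) / (R - 1)) with hc | hc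
  · have hMe : M * (P ^ 2 - 1) = P - p := by rw [hM, hc]; field_simp
    have h1 : P * (R * (P - p)) ≤ P - p + M := by nlinarith
    have h2 : (P - p) * (P * (R * (P ^ 2 - 1))) ≤ (P - p) * (P * P) := by
      nlinarith [mul_le_mul_of_nonneg_right h1 hP2.le]
    have h3 := le_of_mul_le_mul_left h2 (by linarith)
    have h4 := le_of_mul_le_mul_left h3 (by linarith)
    linarith
  · have hMe : M * (R - 1) = (R - r) * (p - 1) := by rw [hM, hc]; field_simp
    have h1 : (P - p) * (R - 1) * (P * R - 1) ≤ (R - r) * (p - 1) * (1 + P - P * R) := by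
      nlinarith [mul_le_mul_of_nonneg_right hb hR1.le]
    have hpos : 0 < (P - p) * (R - 1) * (P * R - 1) :=
      mul_pos (mul_pos (by linarith) hR1) (by nlinarith)
    have hK : 0 < 1 + P - P * R := by
      by_contra! hK
      linarith [mul_nonpos_of_nonneg_of_nonpos hB hK]
    have h2 : (R - r) * (p - 1) * (1 + P - P * R) ≤ (R - r) * (P - 1) * (1 + P - P * R) :=
      mul_le_mul_of_nonneg_right
        (mul_le_mul_of_nonneg_left (by linarith) (by linarith)) hK.le
    have h3 := lt_of_mul_lt_mul_left (hle hK) (by linarith)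
    linarith

theorem TentOK.rigid {β β' : ℝ} {i j : ℕ} {x : ℕ → Bool} (hβ : 1 < β) (hlt : β < β')
    (hi : 1 ≤ i) (hij : j = i + 1 ∨ i = j + 1 ∧ 2 ≤ j) (h : TentOK (β ^ i) (β ^ j) x)
    (h' : TentOK (β' ^ i) (β' ^ j) x) (hnr : β ^ i < β ^ j * ((β ^ i) ^ 2 - 1)) : False := by
  have hj : 1 ≤ j := by omega
  have hβ0 : 0 ≤ β := by linarith
  have hβ' : 1 < β' := hβ.trans hlt
  have hpos : 0 < β' := by linarith
  have hp : 1 < β ^ i := one_lt_pow₀ hβ (by omega)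
  have hr : 1 < β ^ j := one_lt_pow₀ hβ (by omega)
  have hpP : β ^ i < β' ^ i := pow_lt_pow_left₀ hlt hβ0 (by omega)
  have hrR : β ^ j < β' ^ j := pow_lt_pow_left₀ hlt hβ0 (by omega)
  have hratio : ∀ k, β ^ k * β' ≤ β' ^ k * β' := fun k =>
    mul_le_mul_of_nonneg_right (pow_le_pow_left₀ hβ0 hlt.le k) hpos.le
  have hnr' : β' ^ i < β' ^ j * ((β' ^ i) ^ 2 - 1) := by
    generalize β ^ i = p at *
    generalize β ^ j = r at *
    generalize β' ^ i = P at *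
    generalize β' ^ j = R at *
    have h1 : P * (p ^ 2 - 1) ≤ p * (P ^ 2 - 1) := by
      have h0 : 0 ≤ p * P + 1 := by nlinarith
      have := mul_nonneg h0 (sub_nonneg.2 hpP.le)
      linarith
    have h2 : r * (p ^ 2 - 1) ≤ R * (p ^ 2 - 1) :=
      mul_le_mul_of_nonneg_right hrR.le (by nlinarith)
    have h3 : p * P < p * (R * (P ^ 2 - 1)) :=
      calc p * P < (R * (p ^ 2 - 1)) * P := mul_lt_mul_of_pos_right (by linarith) (by linarith)
        _ = R * (P * (p ^ 2 - 1)) := by ring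
        _ ≤ R * (p * (P ^ 2 - 1)) := mul_le_mul_of_nonneg_left h1 (by linarith)
        _ = p * (R * (P ^ 2 - 1)) := by ring
    exact lt_of_mul_lt_mul_left h3 (by linarith)
  refine h.rigid_of_ineq h' hp hr hpP hrR hnr' fun hK => ?_
  rcases hij with rfl | ⟨rfl, hj2⟩
  · have hPR : β' ^ i ≤ β' ^ (i + 1) := pow_le_pow_right₀ hβ'.le (by omega)
    have hI := rigid_ineq_of_le (hp.trans hpP) hPR hnr'
    have hc : β' ^ i * (β' ^ (i + 1) - β ^ (i + 1)) ≤ 2 * (β' ^ (i + 1) * (β' ^ i - β ^ i)) := by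
      obtain ⟨k, rfl⟩ := Nat.exists_eq_add_of_le' hi
      have e : 2 * (β' ^ (k + 1 + 1) * (β' ^ (k + 1) - β ^ (k + 1))) -
          β' ^ (k + 1) * (β' ^ (k + 1 + 1) - β ^ (k + 1 + 1)) =
          β' ^ (k + 1) * ((β' ^ k - β ^ k) * β' ^ 2 + β ^ k * (β' - β) ^ 2) := by ring
      have : 0 ≤ β' ^ k - β ^ k := sub_nonneg.2 (pow_le_pow_left₀ hβ0 hlt.le k)
      have : 0 ≤ β' ^ (k + 1) * ((β' ^ k - β ^ k) * β' ^ 2 + β ^ k * (β' - β) ^ 2) := by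
        positivity
      linarith
    generalize β ^ i = p at *
    generalize β ^ (i + 1) = r at *
    generalize β' ^ i = P at *
    generalize β' ^ (i + 1) = R at *
    have hP1 : 0 < P - 1 := by linarith
    have hPp : 0 < P - p := by linarith
    have hR1 : 0 < R - 1 := by linarith
    calc P * ((R - r) * (P - 1) * (1 + P - P * R))
        = P * (R - r) * ((P - 1) * (1 + P - P * R)) := by ring
      _ ≤ 2 * (R * (P - p)) * ((P - 1) * (1 + P - P * R)) :=
        mul_le_mul_of_nonneg_right hc (by positivity)
      _ = (R * (P - 1)) * (P - p) * (2 * (1 + P - P * R)) := by ring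
      _ ≤ (P * (R - 1)) * (P - p) * (2 * (1 + P - P * R)) :=
        mul_le_mul_of_nonneg_right
          (mul_le_mul_of_nonneg_right (by linarith) hPp.le) (by positivity)
      _ < (P * (R - 1)) * (P - p) * (P * R - 1) :=
        mul_lt_mul_of_pos_left hI
          (mul_pos (mul_pos (by linarith) hR1) hPp)
      _ = P * ((P - p) * (R - 1) * (P * R - 1)) := by ring
  · have hRP : β' ^ j ≤ β' ^ (j + 1) := pow_le_pow_right₀ hβ'.le (by omega)
    have hPR : (β' ^ (j + 1)) ^ 2 ≤ (β' ^ j) ^ 3 := by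
      rw [← pow_mul, ← pow_mul]
      exact pow_le_pow_right₀ hβ'.le (by omega)
    have hI := rigid_ineq_of_ge (hr.trans hrR) hRP hPR hnr'
    have hc : β' ^ (j + 1) * (β' ^ j - β ^ j) ≤ β' ^ j * (β' ^ (j + 1) - β ^ (j + 1)) := by
      have e : β' ^ j * (β' ^ (j + 1) - β ^ (j + 1)) - β' ^ (j + 1) * (β' ^ j - β ^ j) =
          β' ^ j * (β ^ j * (β' - β)) := by ring
      have : 0 ≤ β' - β := by linarith
      have : 0 ≤ β' ^ j * (β ^ j * (β' - β)) := by positivity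
      linarith
    generalize β ^ (j + 1) = p at *
    generalize β ^ j = r at *
    generalize β' ^ (j + 1) = P at *
    generalize β' ^ j = R at *
    have hP1 : 0 < P - 1 := by linarith
    calc P * ((R - r) * (P - 1) * (1 + P - P * R))
        = P * (R - r) * ((P - 1) * (1 + P - P * R)) := by ring
      _ ≤ R * (P - p) * ((P - 1) * (1 + P - P * R)) :=
        mul_le_mul_of_nonneg_right hc (by positivity)
      _ = (P - p) * (R * (P - 1) * (1 + P - P * R)) := by ring
      _ < (P - p) * (P * (P * R - 1) * (R - 1)) :=
        mul_lt_mul_of_pos_left hI (by linarith)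
      _ = P * ((P - p) * (R - 1) * (P * R - 1)) := by ring

/-- At high levels the renormalization condition fails. -/
theorem exists_level_bound {β : ℝ} (hβ : 1 < β) : ∃ K, ∀ m, K ≤ m →
    β ^ (blk m true).length < β ^ (blk m false).length * ((β ^ (blk m true).length) ^ 2 - 1) := by
  obtain ⟨K, hK⟩ := pow_unbounded_of_one_lt (β + 1) hβ
  refine ⟨K, fun m hm => ?_⟩
  have h1 : β ^ K ≤ β ^ (blk m true).length :=
    pow_le_pow_right₀ hβ.le (hm.trans (lt_blk_length m).le)
  have h2 : β ^ (blk m true).length ≤ β ^ (blk m false).length * β := by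
    rw [← pow_succ]
    refine pow_le_pow_right₀ hβ.le ?_
    have := (blk_length m).2.2
    omega
  have h3 : 0 < β ^ (blk m false).length := by positivity
  have h4 : β < (β ^ (blk m true).length) ^ 2 - 1 := by nlinarith
  nlinarith [mul_lt_mul_of_pos_left h4 h3]

theorem TentOK.unique_blk {β β' : ℝ} (hβ : 1 < β) (hlt : β < β') {m : ℕ} {x : ℕ → Bool}
    (h : TentOK (β ^ (blk m true).length) (β ^ (blk m false).length) x)
    (h' : TentOK (β' ^ (blk m true).length) (β' ^ (blk m false).length) x) : False := by
  obtain ⟨K, hK⟩ := exists_level_bound hβ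
  obtain ⟨d, hd⟩ : ∃ d, K ≤ m + d := ⟨K, by omega⟩
  induction d generalizing m x with
  | zero =>
    exact TentOK.rigid hβ hlt (blk_length m).1.pos (blk_length m).2.2 h h' (hK m hd)
  | succ d ih =>
    by_cases hren : β ^ (blk m true).length <
        β ^ (blk m false).length * ((β ^ (blk m true).length) ^ 2 - 1)
    · exact TentOK.rigid hβ hlt (blk_length m).1.pos (blk_length m).2.2 h h' hren
    · have hx := h.even_true (one_lt_pow_blk hβ m true) (one_lt_pow_blk hβ m false) (not_lt.1 hren)
      exact ih (h.doubling_blk hβ hx) (h'.doubling_blk (hβ.trans hlt) hx) (by omega)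

theorem ClosedAt.base_le {β β' : ℝ} {a : ℕ → ℤ} (hpos : ∀ n, 0 ≤ a n) (hβ : 1 < β)
    (h : ClosedAt β a) (h' : ClosedAt β' a) : β' ≤ β := by
  by_contra! hlt
  rcases le_or_gt (β ^ 2) (β + 1) with hβ2 | hβ2
  · obtain ⟨x, hx, hT⟩ := h.exists_lev hpos hβ hβ2
    exact hT.unique_blk hβ hlt (h'.tentOK (hβ.trans hlt) hx)
  · have hβ'2 : 0 < β' ^ 2 - 1 - β' := by nlinarith
    set e := (β' - β) * β' / (β' ^ 2 - 1) with he
    have hee : e * (β' ^ 2 - 1) = (β' - β) * β' := by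
      rw [he]
      have : β' ^ 2 - 1 ≠ 0 := by nlinarith
      field_simp
    have hstep : ∀ n, β' ^ 2 * (orb β a n - orb β' a n - e) ≤
        orb β a (n + 1 + 1) - orb β' a (n + 1 + 1) - e := by
      intro n
      have h1 := h n
      have h2 := h (n + 1)
      rw [orb] at h2
      rw [orb, orb, orb, orb]
      have h3 : 0 ≤ (β' - β) * β' * (1 - orb β a n) :=
        mul_nonneg (mul_nonneg (by linarith) (by linarith)) (by linarith)
      have h4 : 0 ≤ (β' - β) * (a n + 1 - β * orb β a n) := mul_nonneg (by linarith) h2.1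
      nlinarith
    have hb : orb β a (2 * 0 + 1) - orb β' a (2 * 0 + 1) - e ≤ 0 := by
      refine nonpos_of_contracting (q := β' ^ 2)
        (f := fun k => orb β a (2 * k + 1) - orb β' a (2 * k + 1) - e) (by nlinarith)
        ⟨1 - e, fun k => ?_⟩ (fun C hC hbC k => ?_) 0
      · linarith [(h (2 * k + 1)).2, (h' (2 * k + 1)).1]
      · rw [le_div_iff₀ (by nlinarith)]
        have hk : orb β a (2 * k + 1 + 1 + 1) - orb β' a (2 * k + 1 + 1 + 1) - e ≤ C := hbC (k + 1)
        linarith [hstep (2 * k + 1)]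
    simp only [orb] at hb
    have : (β' - β) * (β' ^ 2 - 1) ≤ (β' - β) * β' := by
      rw [← hee]
      exact mul_le_mul_of_nonneg_right (by linarith) (by nlinarith)
    nlinarith [le_of_mul_le_mul_left this (by linarith)]

theorem ClosedAt.unique {β β' : ℝ} {a : ℕ → ℤ} (hpos : ∀ n, 0 ≤ a n) (hβ : 1 < β) (hβ' : 1 < β')
    (h : ClosedAt β a) (h' : ClosedAt β' a) : β = β' :=
  le_antisymm (ClosedAt.base_le hpos hβ' h' h) (ClosedAt.base_le hpos hβ h h')

/-! ### Comparison with the sequence `u` -/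

theorem uSeq_values : uSeq 0 = 1 ∧ uSeq 1 = 0 ∧ uSeq 2 = 0 ∧ uSeq 3 = 1 := by
  have h := blockAt_uSeq 2
  exact ⟨h 0 (by decide), h 1 (by decide), h 2 (by decide), h 3 (by decide)⟩

theorem ClosedAt.digit_le {β : ℝ} {a : ℕ → ℤ} (h : ClosedAt β a) (n : ℕ) :
    (a n : ℝ) ≤ β * orb β a n := by
  have := (h (n + 1)).2
  rw [orb] at this
  linarith

theorem ClosedAt.uSeq_lt_of_large {β : ℝ} {a : ℕ → ℤ} (h : ClosedAt β a) (hpos : ∀ n, 0 ≤ a n)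
    (hβ : 1 < β) (hβ2 : β + 1 < β ^ 2) : AltLt uSeq a := by
  obtain ⟨u0, u1, u2, u3⟩ := uSeq_values
  have y0 : orb β a 0 = 1 := rfl
  have y1 : orb β a 1 = a 0 + 1 - β := by rw [orb, y0, mul_one]
  have h0 : 1 ≤ a 0 := by
    have := (h 1).1
    have : (0 : ℝ) < a 0 := by linarith
    exact_mod_cast this
  obtain h0 | h0 := h0.lt_or_eq
  · exact altLt_of_first_diff (k := 0) (by simp) (fun _ => by omega) (by simp)
  have y1' : orb β a 1 = 2 - β := by rw [y1, ← h0]; push_cast; ring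
  have h1 : a 1 = 0 := by
    have : (a 1 : ℝ) < 1 := by nlinarith [h.digit_le 1]
    have : a 1 < 1 := by exact_mod_cast this
    have := hpos 1
    omega
  have y2 : orb β a 2 = (β - 1) ^ 2 := by rw [orb, y1', h1]; push_cast; ring
  obtain h2 | h2 := (hpos 2).lt_or_eq
  · refine altLt_of_first_diff (k := 2) ?_ (fun _ => by omega) (fun h => absurd (by decide) h)
    intro i hi
    interval_cases i <;> omega
  have y3 : orb β a 3 = 1 - β * (β - 1) ^ 2 := by rw [orb, y2, ← h2]; push_cast; ring
  have h3 : a 3 = 0 := by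
    have hb : 1 < β * (β - 1) := by nlinarith
    have hb2 : 1 < β * (β * (β - 1)) := by nlinarith
    have hb3 : β - 1 < (β - 1) * (β * (β * (β - 1))) := by nlinarith
    have : (a 3 : ℝ) < 1 := by
      have := h.digit_le 3
      rw [y3] at this
      nlinarith
    have : a 3 < 1 := by exact_mod_cast this
    have := hpos 3
    omega
  refine altLt_of_first_diff (k := 3) ?_ (fun h => absurd h (by decide)) (fun _ => by omega)
  intro i hi
  interval_cases i <;> omega

/-- Letters forced above the renormalization threshold. -/
theorem TentOK.forced {p r : ℝ} {x : ℕ → Bool} (h : TentOK p r x) (hp : 1 < p) (hr : 1 < r)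
    (hren : p < r * (p ^ 2 - 1)) (h2 : x 2 = true) :
    x 3 = true ∧ (x 4 = true → x 5 = true) := by
  have t2 : tent p r x 2 = r * (p - 1) := by
    rw [tent_false (n := 1) (h.one_false hp hr), h.tent_one hr]
  have t3 : tent p r x 3 = p * (1 - r * (p - 1)) := by rw [tent_true h2, t2]
  have h3 : x 3 = true := by
    by_contra hx
    have := h.one_le hr (n := 3) (by simpa using hx)
    rw [t3] at this
    nlinarith [mul_pos (sub_pos.2 hp) (sub_pos.2 hr), mul_pos (sub_pos.2 hp) (sub_pos.2 hp)]
  have t4 : tent p r x 4 = p * (1 - p * (1 - r * (p - 1))) := by rw [tent_true h3, t3]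
  refine ⟨h3, fun h4 => ?_⟩
  by_contra hx
  have := h.one_le hr (n := 5) (by simpa using hx)
  rw [tent_true h4, t4] at this
  have hge : r * (p - 1) ≤ p * (1 - p * (1 - r * (p - 1))) := by
    nlinarith [mul_lt_mul_of_pos_right hren (sub_pos.2 hp)]
  nlinarith [mul_pos (sub_pos.2 hp) (sub_pos.2 hr), mul_pos (sub_pos.2 hp) (sub_pos.2 hp)]

theorem uSeq_lt_of_forced {m : ℕ} {a : ℕ → ℤ} {x : ℕ → Bool} (hx : Parse (blk m) x a)
    (h0 : x 0 = true) (h1 : x 1 = false)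
    (h2 : x 2 = true → x 3 = true ∧ (x 4 = true → x 5 = true)) : AltLt uSeq a := by
  have hu := blockAt_uSeq (m + 3)
  simp only [blk_succ, Bool.not_true, Bool.not_false, blockAt_append, zero_add,
    List.length_append, ← add_assoc] at hu
  obtain ⟨⟨⟨u0, u1⟩, u2, u3⟩, ⟨u4, u5⟩, -⟩ := hu
  obtain ⟨hodd, heven, -⟩ := blk_length m
  have b0 := hx 0
  have b1 := hx 1
  have b2 := hx 2
  have b3 := hx 3
  have b4 := hx 4
  have b5 := hx 5
  simp only [blockPos_succ, blockPos_zero, zero_add, h0, h1] at b0 b1 b2 b3 b4 b5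
  cases x2 : x 2
  · rw [x2] at b2
    refine altLt_of_blocks (m := m) (P := blk m true ++ blk m false) (b := true) ?_ ?_ ?_ ?_ ?_
    · simpa only [blockAt_append, zero_add] using ⟨u0, u1⟩
    · simpa only [blockAt_append, zero_add] using ⟨b0, b1⟩
    · simpa using hodd.add_even heven
    · simpa only [List.length_append] using u2
    · simpa only [List.length_append, Bool.not_true] using b2
  obtain ⟨x3, h45⟩ := h2 x2
  rw [x2] at b2 b3 b4 b5
  rw [x3] at b3 b4 b5
  have e3 : Odd ((blk m true).length + (blk m false).length + (blk m true).length +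
      (blk m true).length) := ((hodd.add_even heven).add_odd hodd).add_odd hodd
  cases x4 : x 4
  · rw [x4] at b4
    refine altLt_of_blocks (m := m) (P := blk m true ++ blk m false ++ blk m true ++ blk m true)
      (b := true) ?_ ?_ ?_ ?_ ?_
    · simpa only [blockAt_append, zero_add, List.length_append] using ⟨⟨⟨u0, u1⟩, u2⟩, u3⟩
    · simpa only [blockAt_append, zero_add, List.length_append] using ⟨⟨⟨b0, b1⟩, b2⟩, b3⟩
    · simpa only [List.length_append, true_iff] using e3
    · simpa only [List.length_append] using u4
    · simpa only [List.length_append, Bool.not_true] using b4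
  rw [x4] at b4 b5
  rw [h45 x4] at b5
  refine altLt_of_blocks (m := m)
    (P := blk m true ++ blk m false ++ blk m true ++ blk m true ++ blk m true)
    (b := false) ?_ ?_ ?_ ?_ ?_
  · simpa only [blockAt_append, zero_add, List.length_append] using ⟨⟨⟨⟨u0, u1⟩, u2⟩, u3⟩, u4⟩
  · simpa only [blockAt_append, zero_add, List.length_append] using ⟨⟨⟨⟨b0, b1⟩, b2⟩, b3⟩, b4⟩
  · simpa only [List.length_append, Bool.false_eq_true, false_iff, Nat.not_odd_iff_even]
      using e3.add_odd hodd
  · simpa only [List.length_append] using u5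
  · simpa only [List.length_append, Bool.not_false] using b5

theorem Lev.uSeq_lt {m : ℕ} {β : ℝ} {a : ℕ → ℤ} {x : ℕ → Bool} (hβ : 1 < β)
    (h : Lev m β a x) : AltLt uSeq a := by
  obtain ⟨K, hK⟩ := exists_level_bound hβ
  obtain ⟨d, hd⟩ : ∃ d, K ≤ m + d := ⟨K, by omega⟩
  have key : ∀ m x, Lev m β a x → β ^ (blk m true).length <
      β ^ (blk m false).length * ((β ^ (blk m true).length) ^ 2 - 1) → AltLt uSeq a := by
    intro m x h hren
    have hp := one_lt_pow_blk hβ m true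
    have hr := one_lt_pow_blk hβ m false
    exact uSeq_lt_of_forced h.1 (h.2.zero_true hr) (h.2.one_false hp hr) (h.2.forced hp hr hren)
  induction d generalizing m x with
  | zero => exact key m x h (hK m hd)
  | succ d ih =>
    by_cases hren : β ^ (blk m true).length <
        β ^ (blk m false).length * ((β ^ (blk m true).length) ^ 2 - 1)
    · exact key m x h hren
    · exact ih (h.succ hβ (h.2.even_true (one_lt_pow_blk hβ m true) (one_lt_pow_blk hβ m false)
        (not_lt.1 hren))) (by omega)

theorem ClosedAt.uSeq_lt {β : ℝ} {a : ℕ → ℤ} (h : ClosedAt β a) (hpos : ∀ n, 0 ≤ a n)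
    (hβ : 1 < β) : AltLt uSeq a := by
  rcases le_or_gt (β ^ 2) (β + 1) with hβ2 | hβ2
  · obtain ⟨x, hx⟩ := h.exists_lev hpos hβ hβ2
    exact hx.uSeq_lt hβ
  · exact h.uSeq_lt_of_large hpos hβ hβ2

theorem eventually_lev (m : ℕ) : ∀ᶠ β : ℝ in nhdsWithin 1 (Ioi 1), ∀ a : ℕ → ℤ, (∀ n, 0 ≤ a n) →
    ClosedAt β a → ∃ x, Lev m β a x := by
  induction m with
  | zero =>
    have h1 : ∀ᶠ β : ℝ in nhdsWithin 1 (Ioi 1), β ^ 2 < β + 1 :=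
      nhdsWithin_le_nhds ((continuousAt_id.pow 2).eventually_lt
        (continuousAt_id.add continuousAt_const) (by norm_num))
    filter_upwards [h1, self_mem_nhdsWithin] with β h1 hβ a hpos ha
    exact ha.exists_lev hpos hβ h1.le
  | succ m ih =>
    have h1 : ∀ᶠ β : ℝ in nhdsWithin 1 (Ioi 1),
        β ^ (blk m false).length * ((β ^ (blk m true).length) ^ 2 - 1) <
          β ^ (blk m true).length := by
      refine nhdsWithin_le_nhds (ContinuousAt.eventually_lt ?_ ?_ (by norm_num)) <;> fun_prop
    filter_upwards [h1, ih, self_mem_nhdsWithin] with β h1 ih hβ a hpos ha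
    obtain ⟨x, hx⟩ := ih a hpos ha
    exact ⟨_, hx.succ hβ (hx.2.even_true (one_lt_pow_blk hβ m true) (one_lt_pow_blk hβ m false)
      h1.le)⟩

theorem exists_negBetaExp_lt {a : ℕ → ℤ} (h : AltLt uSeq a) :
    ∃ β : ℝ, 1 < β ∧ AltLt (negBetaExp β) a := by
  obtain ⟨k, hk, hs⟩ := h
  obtain ⟨β, hlev, hβ⟩ := ((eventually_lev k).and self_mem_nhdsWithin).exists
  refine ⟨β, hβ, AltLt.congr_left hk hs fun i hi => ?_⟩
  obtain ⟨x, hx⟩ := hlev _ (negBetaExp_nonneg hβ) (closedAt_negBetaExp hβ)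
  have h0 := hx.1 0
  rw [hx.2.zero_true (one_lt_pow_blk hβ k false), blockPos_zero] at h0
  have hl : i < (blk k true).length := hi.trans_lt (lt_blk_length k)
  have h1 := h0 i hl
  have h2 := blockAt_uSeq k i hl
  rw [zero_add] at h1 h2
  rw [h1, h2]

/-! ### Existence of the base -/

theorem AltLt.trans {x y z : ℕ → ℤ} (h : AltLt x y) (h' : AltLt y z) : AltLt x z := by
  obtain ⟨k, hk, hs⟩ := h
  obtain ⟨l, hl, hs'⟩ := h'
  rcases lt_trichotomy k l with h | rfl | h
  · exact ⟨k, fun i hi => (hk i hi).trans (hl i (hi.trans h)), by rwa [← hl k h]⟩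
  · refine ⟨k, fun i hi => (hk i hi).trans (hl i hi), ?_⟩
    split_ifs at * <;> omega
  · exact ⟨l, fun i hi => (hk i (hi.trans h)).trans (hl i hi), by rwa [hk l h]⟩

theorem AltLe.trans {x y z : ℕ → ℤ} (h : AltLe x y) (h' : AltLe y z) : AltLe x z := by
  rcases h with h | rfl
  · rcases h' with h' | rfl
    · exact Or.inl (h.trans h')
    · exact Or.inl h
  · exact h'

/-- The alternating order controls the initial values of bounded orbits. -/
theorem orbit_le_of_altLe {β C : ℝ} {b d : ℕ → ℤ} {G H : ℕ → ℝ} (hβ : 1 < β) (hC : 0 ≤ C)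
    (hG : ∀ n, G (n + 1) = b n + 1 - β * G n) (hH : ∀ n, H (n + 1) = d n + 1 - β * H n)
    (hGb : ∀ n, -C ≤ G n ∧ G n ≤ 1 + C) (hHb : ∀ n, 0 ≤ H n ∧ H n ≤ 1) (h : AltLe b d) :
    G 0 ≤ H 0 + C / β := by
  have hdiff : ∀ k, (∀ i, i < k → b i = d i) → G k - H k = (-β) ^ k * (G 0 - H 0) := by
    intro k hk
    induction k with
    | zero => simp
    | succ k ih =>
      rw [hG, hH, hk k (by omega), pow_succ]
      linear_combination -β * ih fun i hi => hk i (by omega)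
  have hCβ : 0 ≤ C / β := by positivity
  by_contra! hlt
  have hpos : 0 < G 0 - H 0 := by linarith
  rcases h with ⟨k, hk, hs⟩ | rfl
  · have e := hdiff k hk
    have e1 : β * ((-β) ^ k * (G 0 - H 0)) = (b k - d k) - (G (k + 1) - H (k + 1)) := by
      rw [← e, hG, hH]; ring
    have hg := hGb (k + 1)
    have hh := hHb (k + 1)
    have hfin : β ^ k * (β * (G 0 - H 0)) ≤ C := by
      split_ifs at hs with hev
      · have : (b k : ℝ) + 1 ≤ d k := by exact_mod_cast hs
        rw [hev.neg_pow] at e1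
        linarith
      · have : (d k : ℝ) + 1 ≤ b k := by exact_mod_cast hs
        rw [(Nat.not_even_iff_odd.1 hev).neg_pow] at e1
        linarith
    have h1 : 1 ≤ β ^ k := one_le_pow₀ hβ.le
    have h2 : 0 ≤ β * (G 0 - H 0) := by positivity
    have h3 : C / β < G 0 - H 0 := by linarith
    rw [div_lt_iff₀ (by linarith)] at h3
    nlinarith
  · obtain ⟨k, hk⟩ := pow_unbounded_of_one_lt ((1 + C) / (G 0 - H 0)) hβ
    rw [div_lt_iff₀ hpos] at hk
    have e := hdiff k fun _ _ => rfl
    have h1 : |G k - H k| = β ^ k * (G 0 - H 0) := by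
      rw [e, abs_mul, abs_pow, abs_neg, abs_of_pos (by linarith : 0 < β), abs_of_pos hpos]
    have h2 : |G k - H k| ≤ 1 + C := by
      have := hGb k
      have := hHb k
      rw [abs_le]
      constructor <;> linarith
    linarith

theorem exists_bounded_orbit {β : ℝ} (hβ : 1 < β) {a : ℕ → ℤ} {M : ℤ}
    (ha : ∀ n, 0 ≤ a n ∧ a n ≤ M) :
    ∃ G : ℕ → ℝ, (∀ n, G (n + 1) = a n + 1 - β * G n) ∧ ∃ C, ∀ n, |G n| ≤ C := by
  have hβ0 : 0 < β := by linarith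
  have hq : β⁻¹ < 1 := inv_lt_one_of_one_lt₀ hβ
  have hq0 : 0 ≤ β⁻¹ := by positivity
  have hbd : ∀ n i, ‖((a (n + i) : ℝ) + 1) * (-β⁻¹) ^ i * β⁻¹‖ ≤ (M + 1) * β⁻¹ ^ i * β⁻¹ := by
    intro n i
    have h1 : (0 : ℝ) ≤ a (n + i) := by exact_mod_cast (ha (n + i)).1
    have h2 : (a (n + i) : ℝ) ≤ M := by exact_mod_cast (ha (n + i)).2
    rw [Real.norm_eq_abs, abs_mul, abs_mul, abs_pow, abs_neg, abs_of_nonneg hq0,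
      abs_of_nonneg (by linarith : (0 : ℝ) ≤ a (n + i) + 1)]
    gcongr
  have hs : Summable fun i : ℕ => ((M : ℝ) + 1) * β⁻¹ ^ i * β⁻¹ :=
    ((summable_geometric_of_lt_one hq0 hq).mul_left _).mul_right _
  have hsn : ∀ n, Summable fun i => ((a (n + i) : ℝ) + 1) * (-β⁻¹) ^ i * β⁻¹ := fun n =>
    Summable.of_norm_bounded hs (hbd n)
  refine ⟨fun n => ∑' i, ((a (n + i) : ℝ) + 1) * (-β⁻¹) ^ i * β⁻¹, fun n => ?_,
    ∑' i : ℕ, ((M : ℝ) + 1) * β⁻¹ ^ i * β⁻¹, fun n => ?_⟩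
  · have e : ∑' i, ((a (n + (i + 1)) : ℝ) + 1) * (-β⁻¹) ^ (i + 1) * β⁻¹ =
        -β⁻¹ * ∑' i, ((a (n + 1 + i) : ℝ) + 1) * (-β⁻¹) ^ i * β⁻¹ := by
      rw [← tsum_mul_left]
      refine tsum_congr fun i => ?_
      rw [show n + (i + 1) = n + 1 + i by ring]
      ring
    simp only
    rw [(hsn n).tsum_eq_zero_add, e, add_zero, pow_zero]
    field_simp
    ring
  · rw [← Real.norm_eq_abs]
    exact tsum_of_norm_bounded hs.hasSum (hbd n)

theorem closedAt_of_between {β : ℝ} (hβ : 1 < β) {a c c' : ℕ → ℤ} {M : ℤ}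
    (ha : ∀ n, 0 ≤ a n ∧ a n ≤ M) (hG : CondG a) (hc : ClosedAt β c) (hc' : ClosedAt β c')
    (hca : AltLe c a) (hac' : AltLe a c') : ClosedAt β a := by
  obtain ⟨G, hrec, C, hC⟩ := exists_bounded_orbit hβ ha
  have hGc' : ∀ n, AltLe (fun i => a (i + n)) c' := by
    intro n
    rcases Nat.eq_zero_or_pos n with rfl | hn
    · exact hac'
    · exact (hG n hn).trans hac'
  have hmain : ∀ n, max (G n - 1) (-G n) ≤ 0 := by
    refine nonpos_of_contracting hβ ⟨C, fun n => ?_⟩ fun C hC hb n => ?_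
    · have := abs_le.1 (hC n)
      exact max_le (by linarith) (by linarith)
    · have hb' : ∀ n, -C ≤ G n ∧ G n ≤ 1 + C := fun n => by
        have h1 := (le_max_left _ _).trans (hb n)
        have h2 := (le_max_right _ _).trans (hb n)
        constructor <;> linarith
      refine max_le ?_ ?_
      · have := orbit_le_of_altLe (G := fun i => G (i + n)) (H := orb β c') hβ hC
          (fun i => by rw [← hrec (i + n)]; congr 1; ring) (fun _ => rfl) (fun i => hb' _) hc'
          (hGc' n)
        simp only [zero_add, orb] at this
        linarith
      · rw [le_div_iff₀ (by linarith)]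
        have h1 := hrec n
        have h2 : (0 : ℝ) ≤ a n := by exact_mod_cast (ha n).1
        linarith [(hb' (n + 1)).2]
  have hG01 : ∀ n, 0 ≤ G n ∧ G n ≤ 1 := fun n => by
    have h1 := (le_max_left _ _).trans (hmain n)
    have h2 := (le_max_right _ _).trans (hmain n)
    constructor <;> linarith
  have h0 : G 0 = 1 := by
    refine le_antisymm (hG01 0).2 ?_
    have := orbit_le_of_altLe (C := 0) (G := orb β c) (H := G) hβ le_rfl (fun _ => rfl) hrec
      (fun n => by simpa using hc n) hG01 hca
    simpa [orb] using this
  have he : ∀ n, orb β a n = G n := by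
    intro n
    induction n with
    | zero => rw [h0, orb]
    | succ n ih => rw [orb, ih, hrec]
  exact fun n => by rw [he]; exact hG01 n

theorem exists_closedAt_limit {b : ℕ → ℕ → ℤ} {t : ℕ → ℝ} {s : ℝ} {M : ℤ}
    (hb : ∀ n i, 0 ≤ b n i ∧ b n i ≤ M) (ht : Tendsto t atTop (nhds s))
    (hc : ∀ n, ClosedAt (t n) (b n)) :
    ∃ c, ClosedAt s c ∧ ∀ N, ∃ n, ∀ i, i < N → b n i = c i := by
  have hK : IsCompact (Set.pi Set.univ fun _ : ℕ => Set.Icc (0 : ℤ) M) :=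
    isCompact_univ_pi fun _ => (Set.finite_Icc 0 M).isCompact
  obtain ⟨c, -, φ, hφ, hlim⟩ := hK.tendsto_subseq (x := b) fun n i _ => hb n i
  have hev : ∀ i, ∀ᶠ n in atTop, b (φ n) i = c i := by
    intro i
    have := (tendsto_pi_nhds.1 hlim) i
    rw [nhds_discrete, tendsto_pure] at this
    exact this
  have hevN : ∀ N, ∀ᶠ n in atTop, ∀ i, i < N → b (φ n) i = c i := by
    intro N
    have := (Filter.eventually_all_finite (Set.finite_Iio N)).2 fun i _ => hev i
    exact this
  refine ⟨c, fun m => ?_, fun N => ?_⟩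
  · have hten : Tendsto (fun n => orb (t (φ n)) c m) atTop (nhds (orb s c m)) :=
      ((continuous_orb c m).tendsto s).comp (ht.comp hφ.tendsto_atTop)
    have hin : ∀ᶠ n in atTop, orb (t (φ n)) c m ∈ Set.Icc (0 : ℝ) 1 := by
      filter_upwards [hevN m] with n hn
      rw [← orb_congr hn]
      exact hc (φ n) m
    exact isClosed_Icc.mem_of_tendsto hten hin
  · obtain ⟨n, hn⟩ := (hevN N).exists
    exact ⟨φ n, hn⟩

theorem exists_closedAt {a : ℕ → ℤ} (hpos : ∀ n, 0 ≤ a n) (hG : CondG a) (hL : CondL a) :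
    ∃ β : ℝ, 1 < β ∧ ClosedAt β a := by
  have ha : ∀ n, 0 ≤ a n ∧ a n ≤ a 0 := by
    intro n
    refine ⟨hpos n, ?_⟩
    rcases Nat.eq_zero_or_pos n with rfl | hn
    · exact le_rfl
    · simpa using ((hG n hn).sign (k := 0) (by simp)).1 (by simp)
  set B : Set ℝ := {β | 1 < β ∧ AltLt (negBetaExp β) a} with hB
  have hne : B.Nonempty := exists_negBetaExp_lt hL
  have hbdd : BddAbove B := by
    refine ⟨a 0 + 1, ?_⟩
    rintro β ⟨hβ, hlt⟩
    have h0 := (AltLe.sign (Or.inl hlt) (k := 0) (by simp)).1 (by simp)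
    rw [negBetaExp_floor hβ, orb, mul_one] at h0
    have h1 : (⌊β⌋ : ℝ) ≤ a 0 := by exact_mod_cast h0
    linarith [Int.lt_floor_add_one β]
  set s := sSup B with hs
  have hs1 : 1 < s := by
    obtain ⟨β, hβ⟩ := hne
    exact hβ.1.trans_le (le_csSup hbdd hβ)
  have hdig : ∀ {β : ℝ}, 1 < β → β ≤ s + 1 → ∀ i, 0 ≤ negBetaExp β i ∧ negBetaExp β i ≤ ⌊s + 1⌋ := by
    intro β hβ hβs i
    refine ⟨negBetaExp_nonneg hβ i, ?_⟩
    rw [negBetaExp_floor hβ]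
    refine Int.floor_le_floor ?_
    nlinarith [orb_negBetaExp hβ i]
  obtain ⟨t, -, htt, htB⟩ := exists_seq_tendsto_sSup hne hbdd
  obtain ⟨c, hc, hcb⟩ := exists_closedAt_limit (b := fun n => negBetaExp (t n))
    (fun n => hdig (htB n).1 (by linarith [le_csSup hbdd (htB n)])) htt
    fun n => closedAt_negBetaExp (htB n).1
  have ht' : Tendsto (fun n : ℕ => s + 1 / ((n : ℝ) + 1)) atTop (nhds s) := by
    simpa using tendsto_one_div_add_atTop_nhds_zero_nat.const_add s
  have hp : ∀ n : ℕ, 0 < 1 / ((n : ℝ) + 1) := fun n => by positivity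
  have hp1 : ∀ n : ℕ, 1 / ((n : ℝ) + 1) ≤ 1 := fun n => by
    rw [div_le_one (by positivity)]
    linarith [(Nat.cast_nonneg n : (0 : ℝ) ≤ n)]
  have h1 : ∀ n : ℕ, 1 < s + 1 / ((n : ℝ) + 1) := fun n => by linarith [hp n]
  obtain ⟨c', hc', hcb'⟩ := exists_closedAt_limit
    (b := fun n : ℕ => negBetaExp (s + 1 / ((n : ℝ) + 1)))
    (fun n => hdig (h1 n) (by linarith [hp1 n])) ht' fun n => closedAt_negBetaExp (h1 n)
  refine ⟨s, hs1, closedAt_of_between hs1 ha hG hc hc' (altLe_of_not_altLt ?_)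
    (altLe_of_not_altLt ?_)⟩
  · rintro ⟨k, hk, hlt⟩
    obtain ⟨n, hn⟩ := hcb (k + 1)
    exact (htB n).2.asymm (AltLt.congr_right hk hlt fun i hi => hn i (by omega))
  · rintro ⟨k, hk, hlt⟩
    obtain ⟨n, hn⟩ := hcb' (k + 1)
    have hmem : s + 1 / ((n : ℝ) + 1) ∈ B :=
      ⟨h1 n, AltLt.congr_left hk hlt fun i hi => hn i (by omega)⟩
    linarith [le_csSup hbdd hmem, hp n]

/-! ### Condition (G) and periodic sequences -/

theorem condG_negBetaExp {β : ℝ} (hβ : 1 < β) : CondG (negBetaExp β) := by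
  intro k _
  refine altLe_of_not_altLt ?_
  rintro ⟨d, hd, hs⟩
  have hf := negBetaExp_floor hβ
  have h1 := (orb_negBetaExp hβ k).2
  generalize negBetaExp β = a at *
  have key : ∀ n, n ≤ d → orb β a (n + k) - orb β a n = (-β) ^ n * (orb β a k - 1) := by
    intro n hn
    induction n with
    | zero => simp [orb]
    | succ n ih =>
      have h1 : orb β a (n + 1 + k) = a (n + k) + 1 - β * orb β a (n + k) := by
        rw [show n + 1 + k = n + k + 1 by ring, orb]
      rw [h1, orb, hd n (by omega), pow_succ]
      linear_combination -β * ih (by omega)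
  have hk := key d le_rfl
  have hp : 0 < β ^ d := by positivity
  have hmono : ∀ {i l}, a i < a l → orb β a i < orb β a l := by
    intro i l h
    by_contra! hle
    have : ⌊β * orb β a l⌋ ≤ ⌊β * orb β a i⌋ :=
      Int.floor_le_floor (mul_le_mul_of_nonneg_left hle (by linarith))
    rw [← hf, ← hf] at this
    omega
  split_ifs at hs with hev
  · have := hmono hs
    rw [hev.neg_pow] at hk
    nlinarith
  · have := hmono hs
    rw [(Nat.not_even_iff_odd.1 hev).neg_pow] at hk
    nlinarith

theorem ClosedAt.orb_period {β : ℝ} {b : ℕ → ℤ} {k : ℕ} (hβ : 1 < β) (h : ClosedAt β b)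
    (hk : ∀ n, b (n + k) = b n) : orb β b k = 1 := by
  by_contra hne
  have key : ∀ n, orb β b (n + k) - orb β b n = (-β) ^ n * (orb β b k - 1) := by
    intro n
    induction n with
    | zero => simp [orb]
    | succ n ih =>
      have h1 : orb β b (n + 1 + k) = b (n + k) + 1 - β * orb β b (n + k) := by
        rw [show n + 1 + k = n + k + 1 by ring, orb]
      rw [h1, orb, hk n, pow_succ]
      linear_combination -β * ih
  have hpos : 0 < |orb β b k - 1| := abs_pos.2 (sub_ne_zero.2 hne)
  obtain ⟨n, hn⟩ := pow_unbounded_of_one_lt (1 / |orb β b k - 1|) hβ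
  rw [div_lt_iff₀ hpos] at hn
  have h1 : |orb β b (n + k) - orb β b n| = β ^ n * |orb β b k - 1| := by
    rw [key, abs_mul, abs_pow, abs_neg, abs_of_pos (by linarith : 0 < β)]
  have h2 : |orb β b (n + k) - orb β b n| ≤ 1 := by
    rw [abs_le]
    constructor <;> linarith [(h (n + k)).1, (h (n + k)).2, (h n).1, (h n).2]
  linarith

theorem orb_periodic {β : ℝ} {b : ℕ → ℤ} {k : ℕ} (hk0 : 0 < k) (hk : ∀ n, b (n + k) = b n)
    (h1 : orb β b k = 1) {P : ℝ → Prop} (hP : ∀ i, i < k → P (orb β b i)) (n : ℕ) :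
    P (orb β b n) := by
  induction n using Nat.strong_induction_on with
  | _ n ih =>
    by_cases hn : n < k
    · exact hP n hn
    · obtain ⟨m, rfl⟩ := Nat.exists_eq_add_of_le (not_lt.1 hn)
      rw [orb_add h1, orb_congr (b := b) fun i _ => by rw [add_comm, hk]]
      exact ih m (by omega)

theorem blockAt_range {a b : ℕ → ℤ} {s j : ℕ} :
    BlockAt a s ((List.range j).map b) ↔ ∀ i, i < j → a (s + i) = b i := by
  unfold BlockAt
  rw [List.length_map, List.length_range]
  refine forall_congr' fun i => forall_congr' fun hi => ?_
  rw [List.getD_eq_getElem _ _ (by simpa using hi)]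
  simp

theorem blockAt_snoc {a b : ℕ → ℤ} {s j : ℕ} {e : ℤ} :
    BlockAt a s ((List.range j).map b ++ [e]) ↔
      (∀ i, i < j → a (s + i) = b i) ∧ a (s + j) = e := by
  rw [blockAt_append, blockAt_range, List.length_map, List.length_range]
  simp [BlockAt]

theorem blockAt_snoc_two {a b : ℕ → ℤ} {s j : ℕ} {e f : ℤ} :
    BlockAt a s ((List.range j).map b ++ [e, f]) ↔
      (∀ i, i < j → a (s + i) = b i) ∧ a (s + j) = e ∧ a (s + j + 1) = f := by
  rw [blockAt_append, blockAt_range, List.length_map, List.length_range]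
  refine and_congr_right fun _ => ⟨fun h => ⟨h 0 (by simp), h 1 (by simp)⟩, ?_⟩
  rintro ⟨h0, h1⟩ i hi
  have : i < 2 := hi
  interval_cases i
  · exact h0
  · exact h1

theorem perSeq_add_length (w : List ℤ) (n : ℕ) : perSeq w (n + w.length) = perSeq w n := by
  simp [perSeq]

theorem blockAt_perSeq (w : List ℤ) : BlockAt (perSeq w) 0 w := by
  intro i hi
  rw [zero_add, perSeq, Nat.mod_eq_of_lt hi]

theorem perSeq_snoc (a : ℕ → ℤ) (j : ℕ) (e : ℤ) :
    (∀ i, i < j → perSeq ((List.range j).map a ++ [e]) i = a i) ∧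
      perSeq ((List.range j).map a ++ [e]) j = e ∧
      ∀ n, perSeq ((List.range j).map a ++ [e]) (n + (j + 1)) =
        perSeq ((List.range j).map a ++ [e]) n := by
  have h := blockAt_snoc.1 (blockAt_perSeq ((List.range j).map a ++ [e]))
  simp only [zero_add] at h
  refine ⟨h.1, h.2, fun n => ?_⟩
  have := perSeq_add_length ((List.range j).map a ++ [e]) n
  simpa using this

theorem eq_mod_of_period {b : ℕ → ℤ} {k : ℕ} (hk : ∀ n, b (n + k) = b n) (n : ℕ) :
    b (n % k) = b n := by
  conv_rhs => rw [← Nat.mod_add_div n k]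
  induction n / k with
  | zero => simp
  | succ q ih => rw [ih, mul_add, mul_one, ← add_assoc, hk]

theorem perSeq_snoc_nonneg {a : ℕ → ℤ} (hpos : ∀ n, 0 ≤ a n) (j : ℕ) {e : ℤ} (he : 0 ≤ e)
    (n : ℕ) : 0 ≤ perSeq ((List.range j).map a ++ [e]) n := by
  obtain ⟨h1, h2, h3⟩ := perSeq_snoc a j e
  rw [← eq_mod_of_period h3 n]
  have := Nat.mod_lt n (Nat.succ_pos j)
  rcases Nat.lt_succ_iff_lt_or_eq.1 this with h | h
  · rw [h1 _ h]; exact hpos _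
  · rw [h, h2]; exact he

theorem isInfConcat_of_step {L : Set (List ℤ)} {a : ℕ → ℤ} (S : ℕ → Prop) (h0 : S 0)
    (hS : ∀ s, S s → ∃ l ∈ L, BlockAt a s l ∧ S (s + l.length)) : IsInfConcat L a := by
  obtain ⟨x, hx⟩ := exists_parse (f := fun l : L => (l : List ℤ)) S h0 fun s hs => by
    obtain ⟨l, hl, h⟩ := hS s hs
    exact ⟨⟨l, hl⟩, h⟩
  exact isInfConcat_iff.2 ⟨fun n => x n, fun n => (x n).2, hx⟩

/-! ### Sufficiency -/

theorem ClosedAt.pos_of_cond {β : ℝ} {a : ℕ → ℤ} (h : ClosedAt β a) (hpos : ∀ n, 0 ≤ a n)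
    (hβ : 1 < β) (hA1 : CondA1 a) (hA2 : CondA2 a) (n : ℕ) : 0 < orb β a n := by
  by_contra hn
  have hn0 : orb β a n = 0 := le_antisymm (not_lt.1 hn) (h n).1
  obtain ⟨m, rfl⟩ : ∃ m, n = m + 1 := by
    refine ⟨n - 1, ?_⟩
    rcases n with _ | n
    · simp [orb] at hn0
    · rfl
  classical
  have hex : ∃ j, orb β a (j + 1) = 0 ∨ orb β a (j + 1) = 1 := ⟨m, Or.inl hn0⟩
  set j := Nat.find hex with hj
  have hjs := Nat.find_spec hex
  rw [← hj] at hjs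
  have hmin : ∀ i, i < j → 0 < orb β a (i + 1) ∧ orb β a (i + 1) < 1 := by
    intro i hi
    have := Nat.find_min hex hi
    rw [not_or] at this
    exact ⟨lt_of_le_of_ne (h _).1 (Ne.symm this.1), lt_of_le_of_ne (h _).2 this.2⟩
  have hmin' : ∀ i, i < j + 1 → 0 < orb β a i := by
    rintro (_ | i) hi
    · simp [orb]
    · exact (hmin i (by omega)).1
  obtain ⟨e, he, hee⟩ : ∃ e : ℤ, (e : ℝ) = β * orb β a j ∧
      (orb β a (j + 1) = 1 ∧ e = a j ∨ orb β a (j + 1) = 0 ∧ e = a j + 1) := by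
    rcases hjs with hjs | hjs
    · refine ⟨a j + 1, ?_, Or.inr ⟨hjs, rfl⟩⟩
      rw [orb] at hjs
      push_cast
      linarith
    · refine ⟨a j, ?_, Or.inl ⟨hjs, rfl⟩⟩
      rw [orb] at hjs
      linarith
  have he0 : 0 ≤ e := by have := hpos j; omega
  obtain ⟨v1, v2, v3⟩ := perSeq_snoc a j e
  set V := (List.range j).map a ++ [e] with hV
  have hvorb : ∀ i, i < j + 1 → orb β (perSeq V) i = orb β a i := fun i hi =>
    orb_congr fun l hl => v1 l (by omega)
  have hvone : orb β (perSeq V) (j + 1) = 1 := by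
    rw [orb, v2, hvorb j (by omega), he]; ring
  have hvc : ClosedAt β (perSeq V) :=
    orb_periodic (P := fun y => 0 ≤ y ∧ y ≤ 1) (by omega) v3 hvone fun i hi => by
      rw [hvorb i hi]; exact h i
  have hvu : AltLt uSeq (perSeq V) := hvc.uSeq_lt (perSeq_snoc_nonneg hpos j he0) hβ
  have hcat : IsInfConcat {V, (List.range j).map a ++ [e - 1, 0]} a := by
    refine isInfConcat_of_step (fun s => orb β a s = 1) rfl fun s hs => ?_
    have hdig : ∀ i, i ≤ j → orb β a (s + i) = orb β a i ∧ ∀ l, l < i → a (s + l) = a l := by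
      intro i hi
      induction i with
      | zero => exact ⟨by simpa [orb] using hs, by simp⟩
      | succ i ih =>
        obtain ⟨ih1, ih2⟩ := ih (by omega)
        have h1 := h (s + (i + 1))
        have h2 := hmin i (by omega)
        rw [← add_assoc, orb, ih1] at h1
        rw [orb] at h2
        have h3 : (a (s + i) : ℝ) < a i + 1 := by linarith
        have h4 : (a i : ℝ) < a (s + i) + 1 := by linarith
        have h5 : a (s + i) < a i + 1 := by exact_mod_cast h3
        have h6 : a i < a (s + i) + 1 := by exact_mod_cast h4
        have h7 : a (s + i) = a i := by omega
        refine ⟨by rw [← add_assoc, orb, orb, ih1, h7], fun l hl => ?_⟩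
        rcases Nat.lt_succ_iff_lt_or_eq.1 hl with hl | rfl
        · exact ih2 l hl
        · exact h7
    obtain ⟨d1, d2⟩ := hdig j le_rfl
    have hy : orb β a (s + j + 1) = a (s + j) + 1 - e := by rw [orb, d1, he]
    have hc := h (s + j + 1)
    rw [hy] at hc
    have h1 : (e : ℝ) ≤ a (s + j) + 1 := by linarith
    have h2 : (a (s + j) : ℝ) ≤ e := by linarith
    have h3 : e ≤ a (s + j) + 1 := by exact_mod_cast h1
    have h4 : a (s + j) ≤ e := by exact_mod_cast h2
    obtain h5 | h5 : a (s + j) = e ∨ a (s + j) = e - 1 := by omega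
    · refine ⟨V, by simp, blockAt_snoc.2 ⟨d2, h5⟩, ?_⟩
      have : s + V.length = s + j + 1 := by simp [hV]; ring
      rw [this, hy, h5]
      ring
    · have hz : orb β a (s + j + 1) = 0 := by rw [hy, h5]; push_cast; ring
      have h6 := h.digit_le (s + j + 1)
      rw [hz, mul_zero] at h6
      have h7 : a (s + j + 1) ≤ 0 := by exact_mod_cast h6
      have h8 : a (s + j + 1) = 0 := le_antisymm h7 (hpos _)
      refine ⟨_, by simp, blockAt_snoc_two.2 ⟨d2, h5, h8⟩, ?_⟩
      have : s + ((List.range j).map a ++ [e - 1, 0]).length = s + j + 1 + 1 := by simp; ring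
      rw [this, orb, hz, h8]
      simp
  have hrange : (List.range (j + 1)).map a = (List.range j).map a ++ [a j] := by
    simp [List.range_succ]
  rcases hee with ⟨-, rfl⟩ | ⟨-, rfl⟩
  · have := hA1 (j + 1) (by omega)
    rw [Nat.add_sub_cancel, hrange] at this
    have hav := this hvu hcat
    have := orb_periodic (P := fun y => 0 < y) (by omega) v3 hvone
      (fun i hi => by rw [hvorb i hi]; exact hmin' i hi) (m + 1)
    rw [← hav, hn0] at this
    exact lt_irrefl _ this
  · have := hA2 (j + 1) (by omega)
    rw [Nat.add_sub_cancel, hrange] at this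
    refine this hvu ?_
    rw [Set.pair_comm]
    simpa using hcat

/-! ### Necessity -/

/-- A periodic sequence all of whose blocks essentially occur in `a` inherits condition (G). -/
theorem condG_of_blocks {a v : ℕ → ℤ} {j s : ℕ} (hG : CondG a) (ha : ∀ i, i < j → v i = a i)
    (he : v j = a j ∨ v j = a j + 1) (hk : ∀ n, v (n + (j + 1)) = v n)
    (hs : ∀ i, i < j + 1 → a (s + i) = v i) (hs' : ∀ i, i < j → a (s + (j + 1) + i) = v i) :
    CondG v := by
  intro T₀ _
  obtain ⟨T, hTk, hT⟩ : ∃ T, T < j + 1 ∧ ∀ n, v (n + T₀) = v (n + T) := by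
    refine ⟨T₀ % (j + 1), Nat.mod_lt _ (by omega), fun n => ?_⟩
    rw [← eq_mod_of_period hk (n + T₀), ← eq_mod_of_period hk (n + T₀ % (j + 1)), Nat.add_mod_mod]
  rw [show (fun n => v (n + T₀)) = fun n => v (n + T) from funext hT]
  rcases Nat.eq_zero_or_pos T with rfl | hT0
  · exact Or.inr rfl
  refine altLe_of_not_altLt ?_
  rintro ⟨d, hd, hsd⟩
  beta_reduce at hd hsd
  have hne : v d ≠ v (d + T) := by split_ifs at hsd <;> omega
  obtain ⟨T', hT'⟩ : ∃ T', T + T' = j + 1 := ⟨j + 1 - T, by omega⟩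
  have hdk : d < j + 1 := by
    by_contra hc
    obtain ⟨m, rfl⟩ := Nat.exists_eq_add_of_le (not_lt.1 hc)
    apply hne
    rw [show j + 1 + m + T = m + T + (j + 1) by ring, add_comm (j + 1) m, hk, hk]
    exact hd m (by omega)
  by_cases hdT : d + T < j + 1
  · have h := (hG (s + T) (by omega)).sign (k := d) fun i hi => by
      rw [show i + (s + T) = s + (i + T) by ring, hs _ (by omega), ← hd i hi, ha i (by omega)]
    rw [show d + (s + T) = s + (d + T) by ring, hs _ (by omega), ← ha d (by omega)] at h
    split_ifs at hsd with hev
    · exact absurd (h.1 hev) (by omega)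
    · exact absurd (h.2 hev) (by omega)
  obtain ⟨f, rfl⟩ : ∃ f, d = f + T' := ⟨d - T', by omega⟩
  have hwrap : ∀ i, v (i + T' + T) = v i := fun i => by
    rw [show i + T' + T = i + (j + 1) by omega, hk]
  rw [hwrap] at hsd
  by_cases hpar : Even T'
  · have hshift : ∀ i, i ≤ f + T' → a (i + (s + T)) = v (i + T) := by
      intro i hi
      by_cases hiT : i < T'
      · rw [show i + (s + T) = s + (i + T) by ring, hs _ (by omega)]
      · obtain ⟨m, rfl⟩ := Nat.exists_eq_add_of_le' (not_lt.1 hiT)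
        rw [hwrap, show m + T' + (s + T) = s + (j + 1) + m by omega, hs' _ (by omega)]
    have h := (hG (s + T) (by omega)).sign (k := f + T') fun i hi => by
      rw [hshift i hi.le, ← hd i hi, ha i (by omega)]
    rw [hshift _ le_rfl, hwrap] at h
    have hav : a (f + T') ≠ v (f + T') := by
      intro hav
      rw [hav] at h
      split_ifs at hsd with hev
      · exact absurd (h.1 hev) (by omega)
      · exact absurd (h.2 hev) (by omega)
    have hfj : f + T' = j := by
      by_contra hc
      exact hav (ha _ (by omega)).symm
    rw [hfj] at hav
    obtain ⟨t, rfl⟩ : ∃ t, T' = t + 1 := ⟨T' - 1, by omega⟩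
    have h2 := (hG T hT0).sign (k := t) fun i hi => by
      rw [← ha _ (by omega), ← hd i (by omega), ha i (by omega)]
    have h3 := h2.2 (by simpa [Nat.even_add_one] using hpar)
    have h4 := hd t (by omega)
    rw [show t + T = j by omega] at h3 h4
    rw [ha t (by omega)] at h4
    omega
  · have h := (hG (s + T') (by omega)).sign (k := f) fun i hi => by
      rw [show i + (s + T') = s + (i + T') by ring, hs _ (by omega), hd _ (by omega), hwrap,
        ha i (by omega)]
    rw [show f + (s + T') = s + (f + T') by ring, hs _ (by omega), ← ha f (by omega)] at h
    simp only [Nat.even_add, hpar, iff_false] at hsd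
    split_ifs at hsd with hev
    · exact absurd (h.1 hev) (by omega)
    · exact absurd (h.2 hev) (by omega)

theorem ClosedAt.of_blocks {β : ℝ} {a v : ℕ → ℤ} {j : ℕ} (hv : ClosedAt β v)
    (h1 : orb β v (j + 1) = 1) {w : ℕ → List ℤ}
    (hw : ∀ n, w n = (List.range j).map v ++ [v j] ∨ w n = (List.range j).map v ++ [v j - 1, 0])
    (hp : Parse id w a) : ClosedAt β a := by
  have key : ∀ N, N ≤ blockPos id w N ∧ orb β a (blockPos id w N) = 1 ∧
      ∀ i, i ≤ blockPos id w N → 0 ≤ orb β a i ∧ orb β a i ≤ 1 := by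
    intro N
    induction N with
    | zero => simp [orb]
    | succ N ih =>
      obtain ⟨ih1, ih2, ih3⟩ := ih
      have hb := hp N
      rw [blockPos_succ]
      set s := blockPos id w N
      have horb : ∀ n, (∀ i, i < n → a (s + i) = v i) → orb β a (s + n) = orb β v n :=
        fun n h => (orb_add ih2 n).trans (orb_congr h)
      rcases hw N with h | h
      · rw [h, id, blockAt_snoc] at hb
        have hl : s + (id (w N)).length = s + (j + 1) := by rw [h]; simp
        have hd : ∀ i, i < j + 1 → a (s + i) = v i := fun i hi => by
          rcases Nat.lt_succ_iff_lt_or_eq.1 hi with hi | rfl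
          exacts [hb.1 i hi, hb.2]
        rw [hl]
        refine ⟨by omega, (horb _ hd).trans h1, fun i hi => ?_⟩
        by_cases his : i ≤ s
        · exact ih3 i his
        obtain ⟨m, rfl⟩ := Nat.exists_eq_add_of_le (not_le.1 his).le
        rw [horb m fun i hi => hd i (by omega)]
        exact hv m
      · rw [h, id, blockAt_snoc_two] at hb
        have hl : s + (id (w N)).length = s + (j + 1 + 1) := by rw [h]; simp
        have hz : orb β a (s + (j + 1)) = 0 := by
          rw [← add_assoc, orb, horb j hb.1, hb.2.1]
          rw [orb] at h1
          push_cast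
          linarith
        have ho : orb β a (s + (j + 1 + 1)) = 1 := by
          rw [← add_assoc, orb, hz, ← add_assoc, hb.2.2]
          simp
        rw [hl]
        refine ⟨by omega, ho, fun i hi => ?_⟩
        by_cases his : i ≤ s
        · exact ih3 i his
        obtain ⟨m, rfl⟩ := Nat.exists_eq_add_of_le (not_le.1 his).le
        obtain hm | rfl | rfl : m ≤ j ∨ m = j + 1 ∨ m = j + 1 + 1 := by omega
        · rw [horb m fun i hi => hb.1 i (by omega)]
          exact hv m
        · rw [hz]; norm_num
        · rw [ho]; norm_num
  exact fun n => (key n).2.2 n (key n).1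

/-- A `(-β)`-expansion of the endpoint that is a concatenation of the blocks attached to a
periodic sequence above `uSeq` determines the same base as that periodic sequence. -/
theorem closedAt_perSeq_of_parse {β : ℝ} (hβ : 1 < β) {j : ℕ} {e : ℤ} {a : ℕ → ℤ}
    (ha : ∀ n, a n = negBetaExp β n) (he : e = a j ∨ e = a j + 1) {w : ℕ → List ℤ}
    (hw : ∀ n, w n = (List.range j).map a ++ [e] ∨ w n = (List.range j).map a ++ [e - 1, 0])
    (hp : Parse id w a) (hN : ∃ N, w N = (List.range j).map a ++ [e])
    (hu : AltLt uSeq (perSeq ((List.range j).map a ++ [e]))) :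
    ClosedAt β (perSeq ((List.range j).map a ++ [e])) := by
  have haf : a = negBetaExp β := funext ha
  have hpos : ∀ n, 0 ≤ a n := fun n => haf ▸ negBetaExp_nonneg hβ n
  have hG : CondG a := haf ▸ condG_negBetaExp hβ
  have hc : ClosedAt β a := haf ▸ closedAt_negBetaExp hβ
  obtain ⟨v1, v2, v3⟩ := perSeq_snoc a j e
  have hvpos := perSeq_snoc_nonneg hpos j (e := e) (by have := hpos j; omega)
  generalize perSeq ((List.range j).map a ++ [e]) = v at *
  have hmap : (List.range j).map a = (List.range j).map v := by
    refine List.map_congr_left fun i hi => (v1 i ?_).symm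
    simpa using hi
  rw [hmap, ← v2] at hN
  simp only [hmap, ← v2] at hw
  obtain ⟨N, hN⟩ := hN
  have hbN := hp N
  rw [hN, id, blockAt_snoc] at hbN
  have hbN' := hp (N + 1)
  rw [blockPos_succ, hN] at hbN'
  have hnext : ∀ i, i < j → a (blockPos id w N + (j + 1) + i) = v i := by
    have : blockPos id w N + (id ((List.range j).map v ++ [v j])).length =
        blockPos id w N + (j + 1) := by simp
    rw [this] at hbN'
    rcases hw (N + 1) with h | h <;> rw [h, id, blockAt_append, blockAt_range] at hbN' <;>
      exact hbN'.1
  have hvG : CondG v := condG_of_blocks hG v1 (by rwa [v2]) v3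
    (fun i hi => by
      rcases Nat.lt_succ_iff_lt_or_eq.1 hi with hi | rfl
      exacts [hbN.1 i hi, hbN.2]) hnext
  obtain ⟨β', hβ', hv⟩ := exists_closedAt hvpos hvG hu
  have hca : ClosedAt β' a := hv.of_blocks (hv.orb_period hβ' v3) hw hp
  rwa [hc.unique hpos hβ hβ' hca]

theorem condA1_negBetaExp {β : ℝ} (hβ : 1 < β) : CondA1 (negBetaExp β) := by
  intro k hk hu hcat
  obtain ⟨j, rfl⟩ : ∃ j, k = j + 1 := ⟨k - 1, by omega⟩
  have hrange : (List.range (j + 1)).map (negBetaExp β) =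
      (List.range j).map (negBetaExp β) ++ [negBetaExp β j] := by
    simp [List.range_succ]
  rw [Nat.add_sub_cancel] at hcat
  rw [hrange] at hu hcat ⊢
  obtain ⟨w, hw, hp⟩ := isInfConcat_iff.1 hcat
  have h0 : w 0 = (List.range j).map (negBetaExp β) ++ [negBetaExp β j] := by
    refine (hw 0).resolve_right fun h => ?_
    have hb := hp 0
    rw [h, id, blockAt_snoc_two, blockPos_zero, zero_add] at hb
    have := hb.2.1
    omega
  have hv := closedAt_perSeq_of_parse hβ (fun _ => rfl) (Or.inl rfl) hw hp ⟨0, h0⟩ hu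
  obtain ⟨v1, -, v3⟩ := perSeq_snoc (negBetaExp β) j (negBetaExp β j)
  refine (funext ((eq_negBetaExp_iff hβ).2 fun n => ⟨?_, (hv n).2⟩)).symm
  refine orb_periodic (P := fun y => 0 < y) (by omega) v3 (hv.orb_period hβ v3) (fun i hi => ?_) n
  rw [orb_congr fun l hl => v1 l (by omega)]
  exact (orb_negBetaExp hβ i).1

theorem condA2_negBetaExp {β : ℝ} (hβ : 1 < β) : CondA2 (negBetaExp β) := by
  intro k hk hu hcat
  obtain ⟨j, rfl⟩ : ∃ j, k = j + 1 := ⟨k - 1, by omega⟩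
  rw [Nat.add_sub_cancel] at hu hcat
  obtain ⟨w, hw, hp⟩ := isInfConcat_iff.1 hcat
  have hrange : (List.range (j + 1)).map (negBetaExp β) ++ [0] =
      (List.range j).map (negBetaExp β) ++ [negBetaExp β j + 1 - 1, 0] := by
    simp [List.range_succ]
  rw [hrange] at hw
  by_cases hN : ∃ N, w N = (List.range j).map (negBetaExp β) ++ [negBetaExp β j + 1]
  · have hv := closedAt_perSeq_of_parse hβ (fun _ => rfl) (Or.inr rfl)
      (fun n => (hw n).symm) hp hN hu
    obtain ⟨v1, v2, v3⟩ := perSeq_snoc (negBetaExp β) j (negBetaExp β j + 1)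
    have h1 := hv.orb_period hβ v3
    have h2 := (orb_negBetaExp hβ (j + 1)).1
    rw [orb, v2, orb_congr v1] at h1
    rw [orb] at h2
    push_cast at h1
    linarith
  · push Not at hN
    have hall := fun n => (hw n).resolve_right (hN n)
    have hlen : ∀ N, blockPos id w N = N * (j + 1 + 1) := by
      intro N
      induction N with
      | zero => simp
      | succ N ih => rw [blockPos_succ, ih, hall N]; simp; ring
    have hb : ∀ N i, i < j + 1 + 1 →
        negBetaExp β (N * (j + 1 + 1) + i) =
          ((List.range j).map (negBetaExp β) ++ [negBetaExp β j + 1 - 1, 0]).getD i 0 := by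
      intro N i hi
      have := hp N
      rw [hlen, hall, id] at this
      exact this i (by simp; omega)
    have hper : ∀ n, negBetaExp β (n + (j + 1 + 1)) = negBetaExp β n := by
      intro n
      have hm := Nat.mod_lt n (show 0 < j + 1 + 1 by omega)
      have h1 := hb (n / (j + 1 + 1)) _ hm
      have h2 := hb (n / (j + 1 + 1) + 1) _ hm
      rw [← h1, add_one_mul, Nat.div_add_mod'] at h2
      rw [← h2]
      congr 1
      have := Nat.div_add_mod' n (j + 1 + 1)
      omega
    have h1 := (closedAt_negBetaExp hβ).orb_period hβ hper
    have h0 : negBetaExp β (j + 1) = 0 := by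
      have := hp 0
      rw [hall, id, blockAt_snoc_two, blockPos_zero, zero_add] at this
      exact this.2.2
    have hpos := (orb_negBetaExp hβ (j + 1)).1
    rw [orb, h0] at h1
    push_cast at h1
    nlinarith

/-- a sequence of non-negative integers is the (−β)-expansion of
−β/(β+1) for some (necessarily unique) β > 1 iff it satisfies (G), (L), (A1), (A2). -/
theorem stmt_2 (a : ℕ → ℤ) (hpos : ∀ n, 0 ≤ a n) :
    ((∃ β : ℝ, 1 < β ∧ ∀ n, a n = negBetaExp β n) ↔
      (CondG a ∧ CondL a ∧ CondA1 a ∧ CondA2 a)) ∧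
    ∀ β β' : ℝ, 1 < β → 1 < β' → (∀ n, a n = negBetaExp β n) →
      (∀ n, a n = negBetaExp β' n) → β = β' := by
  refine ⟨⟨?_, ?_⟩, ?_⟩
  · rintro ⟨β, hβ, h⟩
    obtain rfl : a = negBetaExp β := funext h
    exact ⟨condG_negBetaExp hβ, (closedAt_negBetaExp hβ).uSeq_lt hpos hβ, condA1_negBetaExp hβ,
      condA2_negBetaExp hβ⟩
  · rintro ⟨hG, hL, hA1, hA2⟩
    obtain ⟨β, hβ, h⟩ := exists_closedAt hpos hG hL
    exact ⟨β, hβ, (eq_negBetaExp_iff hβ).2 fun n =>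
      ⟨h.pos_of_cond hpos hβ hA1 hA2 n, (h n).2⟩⟩
  · intro β β' hβ hβ' h h'
    exact ClosedAt.unique (a := a) hpos hβ hβ'
      (fun n => ((eq_negBetaExp_iff hβ).1 h n).imp_left le_of_lt)
      (fun n => ((eq_negBetaExp_iff hβ').1 h' n).imp_left le_of_lt)
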